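/- arXiv:1709.01379 — 6 statements merged into one kernel-verified Lean document; each statement's English description precedes it below -/
import Mathlib

section
/- Let π : B → M be a surjective unital *-homomorphism from a von Neumann algebra B onto a C*-algebra M, and let q ∈ M be a projection (q = q* = q²). Then there exists a projection p ∈ B with π(p) = q. -/
open scoped ComplexOrder in
lemma aux_zero {M : Type*} [NormedRing M] [StarRing M] [CStarRing M] [CompleteSpace M]
    [NormedAlgebra ℂ M] [StarModule ℂ M] (r W : M) (hr : r * r = r) (hrs : star r = r)
    (hW : star W = W) (h : (2:ℂ) • (r * (W * W) * r) = - r) : r = 0 := by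
  letI : CStarAlgebra M := {}
  letI : PartialOrder M := CStarAlgebra.spectralOrder M
  haveI : StarOrderedRing M := CStarAlgebra.spectralOrderedRing M
  have h1 : 0 ≤ star (W * r) * (W * r) := star_mul_self_nonneg _
  have h2 : 0 ≤ star r * r := star_mul_self_nonneg _
  have h3 : star (W * r) * (W * r) = r * (W * W) * r := by
    rw [star_mul, hW, hrs]; noncomm_ring
  rw [h3] at h1
  rw [hrs, hr] at h2
  have h4 : 0 ≤ -r := by
    rw [← h, two_smul]
    exact add_nonneg h1 h1
  exact le_antisymm (by simpa using h4) h2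

lemma aux_alg {M : Type*} [NormedRing M] [StarRing M] [CStarRing M] [CompleteSpace M]
    [NormedAlgebra ℂ M] [StarModule ℂ M] (q e W V : M) (hq : q * q = q) (hqs : star q = q)
    (he : e * e = e) (hes : star e = e) (hW : star W = W) (hV : star V = V)
    (heW : e * W = W) (hVe : V * e = 0)
    (h : (2:ℂ) • (W * W - V * V) = 2 * q - 1) : e = q := by
  have hWe : W * e = W := by simpa [hW, hes] using congr(star $heW)
  have heV : e * V = 0 := by simpa [hV, hes] using congr(star $hVe)
  have h1 : (2:ℂ) • (W * W) = (2 * q - 1) * e := by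
    rw [← h, smul_mul_assoc, sub_mul, mul_assoc, mul_assoc, hWe, hVe]; simp
  have h2 : (2:ℂ) • (W * W) = e * (2 * q - 1) := by
    rw [← h, mul_smul_comm, mul_sub, ← mul_assoc, ← mul_assoc, heW, heV]; simp
  have hVV : (2:ℂ) • (V * V) = - (2 * q - 1) * (1 - e) := by
    have : (2:ℂ) • (V * V) = (2:ℂ) • (W * W) - (2 * q - 1) := by rw [← h, smul_sub]; abel
    rw [this, h1]; noncomm_ring
  have hc2 : (2:ℂ) • (q * e) = (2:ℂ) • (e * q) := by
    have := h1.symm.trans h2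
    simp only [two_smul]
    rw [sub_mul, mul_sub, one_mul, mul_one, sub_left_inj] at this
    simpa [two_mul, add_mul, mul_add] using this
  have hc : q * e = e * q := smul_right_injective M (two_ne_zero (α := ℂ)) hc2
  have hqe : q * (q * e) = q * e := by rw [← mul_assoc, hq]
  have heqe : e * (q * e) = q * e := by rw [hc, ← mul_assoc, he]
  have hz1 : (1 - q) * e = 0 := by
    apply aux_zero _ W _ _ hW
    · rw [← smul_mul_assoc, ← mul_smul_comm, h1]
      simp only [two_mul, sub_mul, mul_sub, add_mul, mul_add, one_mul, mul_one, mul_assoc, hqe,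
        heqe, he, hq]
      abel
    · simp only [sub_mul, mul_sub, one_mul, mul_assoc, hqe, heqe, he]
      abel
    · rw [star_mul, star_sub, star_one, hqs, hes, sub_mul, mul_sub, hc]; simp
  have hz2 : q * (1 - e) = 0 := by
    apply aux_zero _ V _ _ hV
    · rw [← smul_mul_assoc, ← mul_smul_comm, hVV]
      simp only [two_mul, sub_mul, mul_sub, add_mul, mul_add, one_mul, mul_one, mul_assoc, hqe,
        heqe, he, hq, neg_mul, mul_neg, ← hc]
      abel
    · simp only [sub_mul, mul_sub, one_mul, mul_one, mul_assoc, hqe, heqe, he, hq, ← hc]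
      abel
    · rw [star_mul, star_sub, star_one, hqs, hes, sub_mul, mul_sub, hc]; simp
  rw [sub_mul, one_mul, sub_eq_zero] at hz1
  rw [mul_sub, mul_one, sub_eq_zero] at hz2
  rw [hz1, ← hz2]

lemma cfc_mem_vN {H : Type*} [NormedAddCommGroup H] [InnerProductSpace ℂ H] [CompleteSpace H]
    (B : VonNeumannAlgebra H) (b : H →L[ℂ] H) (hb : b ∈ B) (hs : IsSelfAdjoint b) (f : ℝ → ℝ) :
    cfc f b ∈ B := by
  rw [← VonNeumannAlgebra.commutant_commutant B, VonNeumannAlgebra.mem_commutant_iff]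
  intro g hg
  rw [VonNeumannAlgebra.mem_commutant_iff] at hg
  have : Commute b g := hg b hb
  exact (hs.commute_cfc this f).symm.eq

/-- Projections lift through a surjective unital *-homomorphism from a von Neumann algebra
onto a C*-algebra: if `π : B → M` is surjective and `q ∈ M` is a projection, then there is a
projection `p ∈ B` with `π p = q`. -/
theorem projection_lifts_from_vonNeumann
    {H : Type*} [NormedAddCommGroup H] [InnerProductSpace ℂ H] [CompleteSpace H]
    (B : VonNeumannAlgebra H)
    {M : Type*} [NormedRing M] [StarRing M] [CStarRing M] [CompleteSpace M]
    [NormedAlgebra ℂ M] [StarModule ℂ M]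
    (π : B.toStarSubalgebra →⋆ₐ[ℂ] M) (hπ : Function.Surjective π)
    (q : M) (hq_idem : q * q = q) (hq_sa : star q = q) :
    ∃ p : B.toStarSubalgebra, p * p = p ∧ star p = p ∧ π p = q := by
  obtain ⟨a, ha⟩ := hπ q
  -- b = a + a^* - 1
  obtain ⟨b, hb⟩ : ∃ b : B.toStarSubalgebra, b = a + star a - 1 := ⟨_, rfl⟩
  have hbs : IsSelfAdjoint (b : H →L[ℂ] H) := by
    have : star b = b := by rw [hb]; simp [add_comm]
    exact congr(($this : H →L[ℂ] H))
  have hπb : π b = 2 * q - 1 := by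
    rw [hb, map_sub, map_add, map_star, ha, hq_sa, map_one, two_mul]
  let w := cfc (fun x : ℝ => √x) (b : H →L[ℂ] H)
  let v := cfc (fun x : ℝ => √(-x)) (b : H →L[ℂ] H)
  have hw : w ∈ B := cfc_mem_vN B b b.2 hbs _
  have hv : v ∈ B := cfc_mem_vN B b b.2 hbs _
  have hws : star w = w := (cfc_predicate (R := ℝ) (p := IsSelfAdjoint) _ _ : IsSelfAdjoint w)
  have hvs : star v = v := (cfc_predicate (R := ℝ) (p := IsSelfAdjoint) _ _ : IsSelfAdjoint v)
  have hvw : v * w = 0 := by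
    simp only [v, w]
    rw [← cfc_mul (fun x : ℝ => √(-x)) (fun x : ℝ => √x) (b : H →L[ℂ] H) (by fun_prop)
      (by fun_prop)]
    convert cfc_zero ℝ (b : H →L[ℂ] H) using 2
    funext x
    rcases le_total 0 x with h | h
    · simp [Real.sqrt_eq_zero_of_nonpos (neg_nonpos.2 h)]
    · simp [Real.sqrt_eq_zero_of_nonpos h]
  have hdiff : w * w - v * v = b := by
    simp only [v, w]
    rw [← cfc_mul (fun x : ℝ => √(-x)) (fun x : ℝ => √(-x)) (b : H →L[ℂ] H) (by fun_prop)
      (by fun_prop), ← cfc_mul (fun x : ℝ => √x) (fun x : ℝ => √x) (b : H →L[ℂ] H) (by fun_prop)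
      (by fun_prop), ← cfc_sub _ _ (b : H →L[ℂ] H) (by fun_prop) (by fun_prop)]
    conv_rhs => rw [← cfc_id ℝ (b : H →L[ℂ] H) hbs]
    congr 1
    funext x
    rcases le_total 0 x with h | h
    · simp [Real.sqrt_eq_zero_of_nonpos (neg_nonpos.2 h), Real.mul_self_sqrt h]
    · simp [Real.sqrt_eq_zero_of_nonpos h, Real.mul_self_sqrt (neg_nonneg.2 h)]
  haveI : CompleteSpace v.ker := v.isClosed_ker.completeSpace_coe
  let p := v.ker.starProjection
  have hp : IsStarProjection p := isStarProjection_starProjection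
  have hpB : p ∈ B := by
    rw [VonNeumannAlgebra.IsStarProjection.mem_iff hp]
    intro y hy
    rw [VonNeumannAlgebra.mem_commutant_iff] at hy
    have hc := hy v hv
    have hr : p.range = v.ker := Submodule.range_starProjection _
    rw [hr, Module.End.mem_invtSubmodule]
    intro x hx
    have hx' : v x = 0 := hx
    have : v (y x) = y (v x) := congr($hc x)
    show v (y x) = 0
    rw [this, hx', map_zero]
  have hpw : p * w = w := by
    ext x
    exact Submodule.starProjection_eq_self_iff.2 (show v (w x) = 0 from congr($hvw x))
  have hvp : v * p = 0 := by
    ext x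
    exact (Submodule.starProjection_apply_mem v.ker x : _)
  let P : B.toStarSubalgebra := ⟨p, hpB⟩
  let W : B.toStarSubalgebra := ⟨w, hw⟩
  let V : B.toStarSubalgebra := ⟨v, hv⟩
  have hP : P * P = P := Subtype.ext hp.isIdempotentElem
  have hPs : star P = P := Subtype.ext hp.isSelfAdjoint
  have hWs : star W = W := Subtype.ext hws
  have hVs : star V = V := Subtype.ext hvs
  have hPW : P * W = W := Subtype.ext hpw
  have hVP : V * P = 0 := Subtype.ext hvp
  have hd : W * W - V * V = b := Subtype.ext hdiff
  refine ⟨P, hP, hPs, ?_⟩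
  obtain ⟨c, hc, hc2⟩ : ∃ c : ℂ, star c = c ∧ 2 * (c * c) = 1 := by
    refine ⟨((√(1/2) : ℝ) : ℂ), Complex.conj_ofReal _, ?_⟩
    rw [← Complex.ofReal_mul, Real.mul_self_sqrt (by norm_num)]
    norm_num
  apply aux_alg q (π P) (c • π W) (c • π V) hq_idem hq_sa
  · rw [← map_mul, hP]
  · rw [← map_star, hPs]
  · rw [star_smul, hc, ← map_star, hWs]
  · rw [star_smul, hc, ← map_star, hVs]
  · rw [mul_smul_comm, ← map_mul, hPW]
  · rw [smul_mul_assoc, ← map_mul, hVP, map_zero, smul_zero]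
  · rw [← hπb, ← hd, smul_mul_smul_comm, smul_mul_smul_comm, ← smul_sub, smul_smul, hc2, one_smul,
      map_sub, map_mul, map_mul]
end

section
/- If a unital C*-algebra A is C*-W*-projective, then A admits a unital embedding into the unitization of the cone of A**; in particular, A contains no projections other than 0 and 1. -/
/-- A unital C*-algebra `A` is C*-W*-projective if every unital *-homomorphism from `A` into
a von Neumann algebra lifts through every surjective unital *-homomorphism from a unital
C*-algebra onto that von Neumann algebra. -/
def CstarWstarProjective (A : Type*) [NormedRing A] [StarRing A] [CStarRing A]
    [CompleteSpace A] [NormedAlgebra ℂ A] [StarModule ℂ A] : Prop :=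
  ∀ (B : Type) [NormedRing B] [StarRing B] [CStarRing B] [CompleteSpace B]
    [NormedAlgebra ℂ B] [StarModule ℂ B]
    (H : Type) [NormedAddCommGroup H] [InnerProductSpace ℂ H] [CompleteSpace H]
    (W : VonNeumannAlgebra H)
    (π : B →⋆ₐ[ℂ] W.toStarSubalgebra), Function.Surjective π →
    ∀ φ : A →⋆ₐ[ℂ] W.toStarSubalgebra, ∃ ψ : A →⋆ₐ[ℂ] B, π.comp ψ = φ

theorem CWP_lift {A : Type} [NormedRing A] [StarRing A] [CStarRing A]
    [CompleteSpace A] [NormedAlgebra ℂ A] [StarModule ℂ A]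
    (hA : CstarWstarProjective A)
    (H : Type) [NormedAddCommGroup H] [InnerProductSpace ℂ H]
    [CompleteSpace H] (W : VonNeumannAlgebra H)
    (M' : Type) [NormedRing M'] [StarRing M'] [CStarRing M'] [CompleteSpace M']
    [NormedAlgebra ℂ M'] [StarModule ℂ M']
    (e : M' ≃⋆ₐ[ℂ] W.toStarSubalgebra) (ρ : A →⋆ₐ[ℂ] M') :
    ∃ τ : A →⋆ₐ[ℂ] Unitization ℂ (ZeroAtInftyContinuousMap (Set.Ioc (0 : ℝ) 1) M'),
      ∀ a, algebraMap ℂ M' (τ a).fst + (τ a).snd ⟨1, by simp⟩ = ρ a := by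
  let ev : ZeroAtInftyContinuousMap (Set.Ioc (0 : ℝ) 1) M' →⋆ₙₐ[ℂ] M' :=
    { toFun := fun f => f ⟨1, by simp⟩
      map_smul' := fun _ _ => rfl
      map_zero' := rfl
      map_add' := fun _ _ => rfl
      map_mul' := fun _ _ => rfl
      map_star' := fun _ => rfl }
  let q : Unitization ℂ (ZeroAtInftyContinuousMap (Set.Ioc (0 : ℝ) 1) M') →⋆ₐ[ℂ] M' :=
    Unitization.starLift ev
  have hq : ∀ x, q x = algebraMap ℂ M' x.fst + x.snd ⟨1, by simp⟩ := fun x => rfl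
  have hqs : Function.Surjective q := by
    intro m
    let f : ZeroAtInftyContinuousMap (Set.Ioc (0 : ℝ) 1) M' :=
      { toFun := fun t => (((t : ℝ) : ℂ)) • m
        continuous_toFun := by fun_prop
        zero_at_infty' := by
          rw [Metric.tendsto_nhds]
          intro ε hε
          rw [Filter.Eventually, Filter.mem_cocompact]
          have hδ : 0 < ε / (‖m‖ + 1) := by positivity
          refine ⟨{t | ε / (‖m‖ + 1) ≤ (t : ℝ)}, ?_, ?_⟩
          · rw [Subtype.isCompact_iff]
            have : (Set.image Subtype.val {t : Set.Ioc (0 : ℝ) 1 | ε / (‖m‖ + 1) ≤ (t : ℝ)})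
                = Set.Icc (ε / (‖m‖ + 1)) 1 := by
              ext x
              simp only [Set.mem_image, Set.mem_ofPred_eq, Subtype.exists, Set.mem_Ioc,
                Set.mem_Icc]
              constructor
              · rintro ⟨a, ⟨h1, h2⟩, h3, rfl⟩
                exact ⟨h3, h2⟩
              · rintro ⟨h1, h2⟩
                exact ⟨x, ⟨hδ.trans_le h1, h2⟩, h1, rfl⟩
            rw [this]
            exact isCompact_Icc
          · intro t ht
            simp only [Set.mem_compl_iff, Set.mem_ofPred_eq, not_le] at ht
            have ht0 : 0 < (t : ℝ) := t.2.1
            rw [lt_div_iff₀ (by positivity)] at ht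
            simp only [Set.mem_ofPred_eq, dist_zero_right, norm_smul, Complex.norm_real,
              Real.norm_eq_abs, abs_of_pos ht0]
            nlinarith }
    refine ⟨Unitization.inr f, ?_⟩
    rw [hq]
    simp [f]
  obtain ⟨ψ, hψ⟩ := hA (Unitization ℂ (ZeroAtInftyContinuousMap (Set.Ioc (0 : ℝ) 1) M')) H W
    ((e : M' →⋆ₐ[ℂ] W.toStarSubalgebra).comp q) (fun y => by
      obtain ⟨m, hm⟩ := e.surjective y
      obtain ⟨b, hb⟩ := hqs m
      exact ⟨b, by rw [← hm, ← hb]; rfl⟩)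
    ((e : M' →⋆ₐ[ℂ] W.toStarSubalgebra).comp ρ)
  refine ⟨ψ, fun a => ?_⟩
  have := DFunLike.congr_fun hψ a
  exact e.injective this

theorem CWP_idem {M : Type} [NormedRing M] [NormedAlgebra ℂ M]
    (x : Unitization ℂ (ZeroAtInftyContinuousMap (Set.Ioc (0 : ℝ) 1) M)) (hx : x * x = x)
    (t : Set.Ioc (0 : ℝ) 1) :
    algebraMap ℂ M x.fst + x.snd t = 0 ∨ algebraMap ℂ M x.fst + x.snd t = 1 := by
  have h1 : x.fst * x.fst = x.fst := congrArg (fun y => y.fst) hx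
  have h2 : x.fst • x.snd + x.fst • x.snd + x.snd * x.snd = x.snd := congrArg (fun y => y.snd) hx
  have h3 : x.fst = 0 ∨ x.fst = 1 := by
    have : x.fst * (x.fst - 1) = 0 := by linear_combination h1
    rcases mul_eq_zero.1 this with h | h
    · exact Or.inl h
    · exact Or.inr (sub_eq_zero.1 h)
  set g := x.snd with hg
  have key : ∀ s, ‖g s * g s‖ = ‖g s‖ := by
    intro s
    have h4 := DFunLike.congr_fun h2 s
    simp only [ZeroAtInftyContinuousMap.add_apply, ZeroAtInftyContinuousMap.smul_apply,
      ZeroAtInftyContinuousMap.mul_apply] at h4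
    rcases h3 with h | h
    · rw [h] at h4; simp at h4; rw [h4]
    · rw [h] at h4
      simp only [one_smul] at h4
      have : g s * g s = - g s := by
        rw [← sub_eq_zero] at h4 ⊢
        rw [← h4]; abel
      rw [this, norm_neg]
  have key2 : ∀ s, ‖g s‖ < 1 ↔ g s = 0 := by
    intro s
    constructor
    · intro h
      have := norm_mul_le (g s) (g s)
      rw [key s] at this
      have h0 := norm_nonneg (g s)
      have : ‖g s‖ = 0 := by nlinarith
      exact norm_eq_zero.1 this
    · intro h; simp [h]
  have hcont : Continuous g := map_continuous g
  have hclopen : IsClopen {s | g s = 0} := by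
    refine ⟨isClosed_eq hcont continuous_const, ?_⟩
    have : {s | g s = 0} = {s | ‖g s‖ < 1} := by ext s; exact (key2 s).symm
    rw [this]
    exact isOpen_lt hcont.norm continuous_const
  have hpre : PreconnectedSpace (Set.Ioc (0 : ℝ) 1) :=
    Subtype.preconnectedSpace isPreconnected_Ioc
  have hnc : NoncompactSpace (Set.Ioc (0 : ℝ) 1) := by
    rw [← not_compactSpace_iff, ← isCompact_iff_compactSpace]
    intro h
    have := h.isClosed.closure_eq
    rw [closure_Ioc (by norm_num)] at this
    have h0 : (0 : ℝ) ∈ Set.Icc (0 : ℝ) 1 := by simp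
    rw [this] at h0
    simp at h0
  have hne : {s | g s = 0}.Nonempty := by
    have ht : Filter.Tendsto g (Filter.cocompact _) (nhds 0) := zero_at_infty g
    have := (Metric.tendsto_nhds.1 ht 1 one_pos).exists
    obtain ⟨s, hs⟩ := this
    exact ⟨s, (key2 s).1 (by simpa using hs)⟩
  have huniv := hclopen.eq_univ hne
  have hgt : g t = 0 := by
    have : t ∈ {s | g s = 0} := by rw [huniv]; trivial
    exact this
  rw [hgt]
  rcases h3 with h | h
  · left; simp [h]
  · right; simp [h]

open scoped ComplexOrder in
theorem CWP_state {A : Type} [CStarAlgebra A] [PartialOrder A] [StarOrderedRing A]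
    (p : A) (hp : 0 ≤ p) (hp0 : p ≠ 0) : ∃ g : A →ₚ[ℂ] ℂ, g p ≠ 0 := by
  let C : ProperCone ℝ A := ProperCone.positive ℝ A
  have hC : -p ∉ C := by
    intro h
    have : 0 ≤ -p := h
    exact hp0 (le_antisymm (by simpa using this) hp)
  obtain ⟨f, hf, hfp⟩ := C.hyperplane_separation_point hC
  let f' : A →ₗ[ℝ] ℝ :=
    { toFun := fun x => f (x + star x)
      map_add' := fun x y => by
        rw [← map_add]; congr 1; rw [star_add]; abel
      map_smul' := fun r x => by
        simp [mul_add] }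
  have hF : ∀ x : A, star x = x → Module.Dual.extendRCLike (𝕜 := ℂ) f' x = ((f (x + x) : ℝ) : ℂ) := by
    intro x hx
    have h1 : star (Complex.I • x) = -(Complex.I • x) := by simp [hx]
    have h2 : f' (Complex.I • x) = 0 := by
      change f (Complex.I • x + star (Complex.I • x)) = 0
      rw [h1]; simp
    have h3 : f' x = f (x + x) := by
      change f (x + star x) = _
      rw [hx]
    rw [Module.Dual.extendRCLike_apply]
    simp [h2, h3]
  refine ⟨PositiveLinearMap.mk₀ (Module.Dual.extendRCLike (𝕜 := ℂ) f') ?_, ?_⟩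
  · intro x hx
    rw [hF x (IsSelfAdjoint.of_nonneg hx)]
    have := hf (x + x) (add_nonneg hx hx)
    exact_mod_cast this
  · change Module.Dual.extendRCLike (𝕜 := ℂ) f' p ≠ 0
    rw [hF p (IsSelfAdjoint.of_nonneg hp)]
    rw [map_neg] at hfp
    rw [map_add]
    norm_cast
    intro h
    linarith

open scoped ComplexOrder in
theorem CWP_rep {A : Type} [CStarAlgebra A] [PartialOrder A] [StarOrderedRing A]
    (p : A) (hpp : p * p = p) (hps : star p = p) (hp0 : p ≠ 0) (hp1 : p ≠ 1) :
    ∃ g : A →ₚ[ℂ] ℂ, g.gnsStarAlgHom p ≠ 0 ∧ g.gnsStarAlgHom p ≠ 1 := by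
  have hp : 0 ≤ p := by
    have := star_mul_self_nonneg p
    rwa [hps, hpp] at this
  have hqq : (1 - p) * (1 - p) = 1 - p := by
    rw [mul_sub, sub_mul, sub_mul, hpp]; simp
  have hqs : star (1 - p) = 1 - p := by rw [star_sub, hps, star_one]
  have hq : 0 ≤ 1 - p := by
    have := star_mul_self_nonneg (1 - p)
    rwa [hqs, hqq] at this
  obtain ⟨g₁, h₁⟩ := CWP_state p hp hp0
  obtain ⟨g₂, h₂⟩ := CWP_state (1 - p) hq (sub_ne_zero.2 (Ne.symm hp1))
  let g : A →ₚ[ℂ] ℂ := PositiveLinearMap.mk₀ (g₁.toLinearMap + g₂.toLinearMap) (fun x hx =>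
    add_nonneg (g₁.map_nonneg hx) (g₂.map_nonneg hx))
  have hg : ∀ x, g x = g₁ x + g₂ x := fun x => rfl
  have hgp : g p ≠ 0 := by
    rw [hg]
    exact (add_pos_of_pos_of_nonneg ((g₁.map_nonneg hp).lt_of_ne' h₁) (g₂.map_nonneg hp)).ne'
  have hgq : g (1 - p) ≠ 0 := by
    rw [hg]
    exact (add_pos_of_nonneg_of_pos (g₁.map_nonneg hq) ((g₂.map_nonneg hq).lt_of_ne' h₂)).ne'
  have main : ∀ r : A, r * r = r → star r = r → g r ≠ 0 → g.gnsStarAlgHom r ≠ 0 := by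
    intro r hr hrs hgr h
    have h1 : g.gnsStarAlgHom r ((g.toPreGNS 1 : g.PreGNS) : g.GNS) = 0 := by rw [h]; rfl
    have h2 : g.gnsStarAlgHom r ((g.toPreGNS 1 : g.PreGNS) : g.GNS)
        = ((g.toPreGNS r : g.PreGNS) : g.GNS) := by
      have := g.gnsNonUnitalStarAlgHom_apply_coe (a := r) (b := g.toPreGNS 1)
      rw [PositiveLinearMap.leftMulMapPreGNS_apply] at this
      simpa using this
    rw [h2] at h1
    have h3 : ‖g.toPreGNS r‖ = 0 := by
      rw [← UniformSpace.Completion.norm_coe, h1, norm_zero]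
    have h4 := g.preGNS_norm_sq (g.toPreGNS r)
    rw [h3] at h4
    simp [hr, hrs] at h4
    exact hgr h4.symm
  refine ⟨g, main p hpp hps hgp, fun h => main (1 - p) hqq hqs hgq ?_⟩
  rw [map_sub, h, map_one, sub_self]

/-- Proposition 3.1: if a unital C*-algebra `A` is C*-W*-projective then, for every von
Neumann algebra (presented as a C*-algebra `M'` *-isomorphic to a von Neumann algebra of
operators) in which `A` embeds unitally — in particular for `A**` — the algebra `A` embeds
unitally into the unitization of the cone `C₀((0,1]) ⊗ M'` of that von Neumann algebra;
in particular `A` has no projections other than `0` and `1`. -/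
theorem CstarWstarProjective.embeds_in_unitization_of_cone
    {A : Type} [NormedRing A] [StarRing A] [CStarRing A]
    [CompleteSpace A] [NormedAlgebra ℂ A] [StarModule ℂ A]
    (hA : CstarWstarProjective A) :
    (∀ (H : Type) [NormedAddCommGroup H] [InnerProductSpace ℂ H]
      [CompleteSpace H] (W : VonNeumannAlgebra H)
      (M' : Type) [NormedRing M'] [StarRing M'] [CStarRing M'] [CompleteSpace M']
      [NormedAlgebra ℂ M'] [StarModule ℂ M']
      (e : M' ≃⋆ₐ[ℂ] W.toStarSubalgebra)
      (ρ : A →⋆ₐ[ℂ] M'), Function.Injective ρ →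
      ∃ τ : A →⋆ₐ[ℂ] Unitization ℂ (ZeroAtInftyContinuousMap (Set.Ioc (0 : ℝ) 1) M'),
        Function.Injective τ) ∧
    ∀ p : A, p * p = p → star p = p → p = 0 ∨ p = 1 := by
  refine ⟨?_, ?_⟩
  · intro H _ _ _ W M' _ _ _ _ _ _ e ρ hρ
    obtain ⟨τ, hτ⟩ := CWP_lift hA H W M' e ρ
    refine ⟨τ, fun a b hab => hρ ?_⟩
    rw [← hτ a, ← hτ b, hab]
  · intro p hpp hps
    by_contra! hcon
    let _ : CStarAlgebra A := {}
    let _ : PartialOrder A := CStarAlgebra.spectralOrder A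
    have _ : StarOrderedRing A := CStarAlgebra.spectralOrderedRing A
    obtain ⟨g, h0, h1⟩ := CWP_rep p hpp hps hcon.1 hcon.2
    let W : VonNeumannAlgebra g.GNS :=
      { toStarSubalgebra := ⊤
        centralizer_centralizer' :=
          Set.Subset.antisymm (fun _ _ => trivial) Set.subset_centralizer_centralizer }
    let e : (g.GNS →L[ℂ] g.GNS) ≃⋆ₐ[ℂ] W.toStarSubalgebra :=
      { toFun := fun x => ⟨x, trivial⟩
        invFun := fun x => x.1
        left_inv := fun _ => rfl
        right_inv := fun _ => rfl
        map_mul' := fun _ _ => rfl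
        map_add' := fun _ _ => rfl
        map_star' := fun _ => rfl
        map_smul' := fun _ _ => rfl }
    obtain ⟨τ, hτ⟩ := CWP_lift hA g.GNS W (g.GNS →L[ℂ] g.GNS)
      e g.gnsStarAlgHom
    have hid : τ p * τ p = τ p := by rw [← map_mul, hpp]
    have := CWP_idem (τ p) hid ⟨1, by simp⟩
    rw [hτ p] at this
    exact this.elim h0 h1
end

section
/- Let K be a continuous image of [0,1], x₀ ∈ K, and n ∈ ℕ. Then C₀(K∖{x₀}) ⊗ Mₙ is C*-W*-projective in the non-unital category: for every C*-algebra B, von Neumann algebra M, surjective *-homomorphism q : B → M, and *-homomorphism φ : C₀(K∖{x₀}) ⊗ Mₙ → M, there is a *-homomorphism ψ : C₀(K∖{x₀}) ⊗ Mₙ → B with q∘ψ = φ. -/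
section Helpers
set_option linter.unusedSectionVars false
open Filter Topology


lemma cfcn_cont_eval {X : Type*} [TopologicalSpace X] [CompactSpace X] (k : C(X, ℂ)) (F : ℂ → ℂ)
    (hF : Continuous F) (hF0 : F 0 = 0) (x : X) : (cfcₙ F k) x = F (k x) := by
  let ev : C(X, ℂ) →⋆ₙₐ[ℂ] ℂ :=
    { toFun := fun f => f x
      map_smul' := fun _ _ => rfl
      map_zero' := rfl
      map_add' := fun _ _ => rfl
      map_mul' := fun _ _ => rfl
      map_star' := fun _ => rfl }
  have h1 : ev (cfcₙ F k) = cfcₙ F (ev k) :=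
    NonUnitalStarAlgHom.map_cfcₙ ev F k (hF.continuousOn) hF0 
      (by exact NonUnitalStarAlgHom.instContinuousLinearMapClassComplex.map_continuous ev)
      (by exact ⟨mul_comm _ _⟩) (by exact ⟨mul_comm _ _⟩)
  have h2 : cfcₙ F (k x) = F (k x) := by
    rw [cfcₙ_eq_cfc (hf := hF.continuousOn) (hf0 := hF0)]
    exact cfc_algebraMap (A := ℂ) (k x) F
  exact h1.trans h2

lemma starHom_continuous {A B : Type*} [NonUnitalCStarAlgebra A] [NonUnitalCStarAlgebra B]
    (q : A →⋆ₙₐ[ℂ] B) : Continuous q :=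
  NonUnitalStarAlgHom.instContinuousLinearMapClassComplex.map_continuous q

lemma starHom_nonneg {A B : Type*} [NonUnitalCStarAlgebra A] [PartialOrder A] [StarOrderedRing A]
    [NonUnitalCStarAlgebra B] [PartialOrder B] [StarOrderedRing B]
    (q : A →⋆ₙₐ[ℂ] B) {a : A} (ha : 0 ≤ a) : 0 ≤ q a := by
  exact map_nonneg q ha

/-- equalisation of positive lifts of a projection -/
lemma equalise {ι B D : Type*} [NonUnitalCStarAlgebra B] [PartialOrder B] [StarOrderedRing B]
    [NonUnitalCStarAlgebra D] [PartialOrder D] [StarOrderedRing D]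
    (q : B →⋆ₙₐ[ℂ] D) (P : D) (hP : P * P = P) (hPs : star P = P) (p₀ : B) (hp₀ : q p₀ = P)
    (w : ι → B) (hw : ∀ i, q (star (w i) * w i) = P) (S : Finset ι) :
    ∃ (r : ι → B) (h : B), 0 ≤ h ∧ q h = P ∧ ∀ i ∈ S, q (r i) = P ∧
      star (r i) * (star (w i) * w i) * r i = h * h := by
  classical
  have hP0 : 0 ≤ P := by
    have := star_mul_self_nonneg P
    rwa [hPs, hP] at this
  induction S using Finset.induction_on with
  | empty =>
    refine ⟨fun _ => 0, star p₀ * p₀, star_mul_self_nonneg _, ?_, by simp⟩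
    rw [map_mul, map_star, hp₀, hPs, hP]
  | insert m S hm ih =>
    obtain ⟨r, h, h0, hq, hr⟩ := ih
    have hs : star h = h := (IsSelfAdjoint.of_nonneg h0).star_eq
    set a := star (w m) * w m with ha
    have has : star a = a := by simp [ha]
    set b := h * a * h with hb
    have hb0 : 0 ≤ b := by
      have := star_mul_self_nonneg (w m * h)
      rwa [star_mul, hs, show h * star (w m) * (w m * h) = b by
        simp only [hb, ha, mul_assoc]] at this
    have hqa : q a = P := hw m
    have hqb : q b = P := by rw [hb, map_mul, map_mul, hq, hqa, hP, hP]
    set c := CFC.sqrt b with hc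
    have hc0 : 0 ≤ c := CFC.sqrt_nonneg b
    have hcs : star c = c := (IsSelfAdjoint.of_nonneg hc0).star_eq
    have hcc : c * c = b := CFC.sqrt_mul_sqrt_self b hb0
    have hqc : q c = P := by
      have h1 : 0 ≤ q c := starHom_nonneg q hc0
      have := CFC.sqrt_unique (a := P) (b := q c) (by rw [← map_mul, hcc, hqb]) h1
      rw [← this]
      exact CFC.sqrt_unique hP hP0
    refine ⟨fun i => if i = m then h * c else r i * a * h, b, hb0, hqb, ?_⟩
    intro i hi
    by_cases him : i = m
    · subst him
      simp only [if_true]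
      refine ⟨by rw [map_mul, hq, hqc, hP], ?_⟩
      rw [star_mul, hs, hcs, ← ha]
      calc c * h * a * (h * c) = c * (h * a * h) * c := by simp only [mul_assoc]
        _ = c * (c * c) * c := by rw [← hb, hcc]
        _ = (c * c) * (c * c) := by simp only [mul_assoc]
        _ = b * b := by rw [hcc]
    · simp only [if_neg him]
      obtain ⟨h1, h2⟩ := hr i (by simpa [him] using hi)
      refine ⟨by rw [map_mul, map_mul, h1, hqa, hq, hP, hP], ?_⟩
      rw [star_mul, star_mul, hs, has]
      calc h * (a * star (r i)) * (star (w i) * w i) * (r i * a * h)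
          = h * a * (star (r i) * (star (w i) * w i) * r i) * a * h := by simp only [mul_assoc]
        _ = b * b := by rw [h2, hb]; simp only [mul_assoc]


lemma orth_lift {n : ℕ} {B D : Type*} [NonUnitalCStarAlgebra B] [NonUnitalCStarAlgebra D]
    (q : B →⋆ₙₐ[ℂ] D) (P : D) (V : Fin n → D) (L : Fin n → B) (hL : ∀ i, q (L i) = V i)
    (hV : ∀ i j, star (V i) * V j = if i = j then P else 0) (hVP : ∀ i, V i * P = V i) :
    ∃ w : Fin n → B, (∀ i, q (w i) = V i) ∧ ∀ i j, i ≠ j → star (w i) * w j = 0 := by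
  let p : Fin n → D := fun i => V i * star (V i)
  have hpp : ∀ i j, p i * p j = if i = j then p i else 0 := by
    intro i j
    have : p i * p j = V i * (star (V i) * V j) * star (V j) := by simp only [p, mul_assoc]
    rw [this, hV]
    split_ifs with h
    · subst h; rw [hVP]
    · simp
  let θ : C(Fin n, ℂ) →⋆ₙₐ[ℂ] D :=
    { toFun := fun v => ∑ i, v i • p i
      map_smul' := fun c v => by simp [Finset.smul_sum, mul_smul]
      map_zero' := by simp
      map_add' := fun u v => by simp [add_smul, Finset.sum_add_distrib]
      map_mul' := fun u v => by
        simp only [ContinuousMap.mul_apply, Finset.sum_mul, Finset.mul_sum, smul_mul_assoc,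
          mul_smul_comm, hpp]
        refine Finset.sum_congr rfl fun i _ => ?_
        simp [smul_smul, mul_comm]
      map_star' := fun v => by
        simp [star_sum, p] }
  let κ : C(Fin n, ℂ) := ⟨fun i => ((i : ℕ) + 1 : ℂ), by fun_prop⟩
  let c : B := ∑ i, κ i • (L i * star (L i))
  have hqc : q c = θ κ := by
    simp only [c, map_sum, map_smul, map_mul, map_star, hL]; rfl
  have hcs : IsSelfAdjoint c := by
    rw [IsSelfAdjoint]
    simp [c, star_sum, κ]
  have hcn : IsStarNormal c := hcs.isStarNormal
  let b : Fin n → ℂ → ℂ := fun i z => ((max 0 (1 - 2 * ‖z - ((i : ℕ) + 1 : ℂ)‖) : ℝ) : ℂ)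
  have hbc : ∀ i, Continuous (b i) := fun i => by dsimp [b]; fun_prop
  have hb0 : ∀ i, b i 0 = 0 := by
    intro i
    have h1 : ‖(0:ℂ) - ((i : ℕ) + 1 : ℂ)‖ = (i : ℕ) + 1 := by
      rw [zero_sub, norm_neg]
      have : ((i : ℕ) + 1 : ℂ) = (((i : ℕ) + 1 : ℕ) : ℂ) := by push_cast; rfl
      rw [this, Complex.norm_natCast]; push_cast; rfl
    simp only [b, h1]
    rw [max_eq_left]
    · simp
    · have : (0:ℝ) ≤ (i : ℕ) := by positivity
      linarith
  have hdist : ∀ i j : Fin n, i ≠ j → 1 ≤ ‖((i : ℕ) + 1 : ℂ) - ((j : ℕ) + 1 : ℂ)‖ := by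
    intro i j hij
    have : ((i : ℕ) + 1 : ℂ) - ((j : ℕ) + 1 : ℂ) = (((i : ℕ) - (j : ℕ) : ℤ) : ℂ) := by
      push_cast; ring
    rw [this, Complex.norm_intCast]
    have h2 : ((i : ℕ) - (j : ℕ) : ℤ) ≠ 0 := by
      intro h; apply hij; apply Fin.ext; omega
    exact_mod_cast Int.one_le_abs h2
  have hbκ : ∀ i j : Fin n, b i (κ j) = if i = j then 1 else 0 := by
    intro i j
    split_ifs with h
    · subst h; simp [b, κ]
    · have := hdist j i (Ne.symm h)
      simp only [b, κ, ContinuousMap.coe_mk]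
      rw [max_eq_left (by linarith)]; simp
  have hbb : ∀ i j, i ≠ j → ∀ z, star (b i z) * b j z = 0 := by
    intro i j hij z
    by_contra hne
    have h1 : b i z ≠ 0 := fun h => hne (by simp [h])
    have h2 : b j z ≠ 0 := fun h => hne (by simp [h])
    have key : ∀ i, b i z ≠ 0 → ‖z - ((i : ℕ) + 1 : ℂ)‖ < 1 / 2 := by
      intro i h
      by_contra hh
      apply h
      simp only [b]
      rw [max_eq_left (by linarith)]; simp
    have h3 := key i h1
    have h4 := key j h2
    have h5 := norm_sub_le (z - ((j : ℕ) + 1 : ℂ)) (z - ((i : ℕ) + 1 : ℂ))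
    rw [show (z - ((j : ℕ) + 1 : ℂ)) - (z - ((i : ℕ) + 1 : ℂ)) =
      ((i : ℕ) + 1 : ℂ) - ((j : ℕ) + 1 : ℂ) by ring] at h5
    have := hdist i j hij
    linarith
  let e : Fin n → B := fun i => cfcₙ (b i) c
  have hqe : ∀ i, q (e i) = p i := by
    intro i
    have h1 : q (e i) = cfcₙ (b i) (q c) :=
      NonUnitalStarAlgHom.map_cfcₙ q (b i) c (hbc i).continuousOn (hb0 i)
        (starHom_continuous q) hcn (hcs.map q).isStarNormal
    have hκn : IsStarNormal κ := ⟨mul_comm _ _⟩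
    have h2 : θ (cfcₙ (b i) κ) = cfcₙ (b i) (θ κ) :=
      NonUnitalStarAlgHom.map_cfcₙ θ (b i) κ (hbc i).continuousOn (hb0 i)
        (starHom_continuous θ) hκn (by rw [← hqc]; exact (hcs.map q).isStarNormal)
    rw [h1, hqc, ← h2]
    change ∑ j, (cfcₙ (b i) κ) j • p j = p i
    simp [cfcn_cont_eval κ (b i) (hbc i) (hb0 i), hbκ]
  refine ⟨fun i => e i * L i, fun i => ?_, fun i j hij => ?_⟩
  · rw [map_mul, hqe, hL]
    simp only [p]
    rw [mul_assoc, hV, if_pos rfl, hVP]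
  · have : star (e i) * e j = 0 := by
      simp only [e]
      rw [← cfcₙ_star, ← cfcₙ_mul _ _ _ ((hbc i).star.continuousOn) (by simp [hb0])
        ((hbc j).continuousOn) (hb0 j)]
      have : (fun z => star (b i z) * b j z) = fun _ => 0 := funext (hbb i j hij)
      rw [this]
      exact cfcₙ_const_zero ℂ c
    rw [star_mul]
    calc star (L i) * star (e i) * (e j * L j) = star (L i) * (star (e i) * e j) * L j := by
          simp only [mul_assoc]
      _ = 0 := by rw [this]; simp

lemma cone_lift {n : ℕ} {B D : Type*} [NonUnitalCStarAlgebra B] [PartialOrder B]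
    [StarOrderedRing B] [NonUnitalCStarAlgebra D] [PartialOrder D] [StarOrderedRing D]
    (q : B →⋆ₙₐ[ℂ] D) (P x : D) (V : Fin n → D)
    (hV : ∀ i j, star (V i) * V j = if i = j then P else 0) (hVP : ∀ i, V i * P = V i)
    (hP : P * P = P) (hPs : star P = P) (hPx : P * x = x) (hx : 0 ≤ x)
    (hVr : ∀ i, ∃ b, q b = V i) (hPr : ∃ b, q b = P) (hxr : ∃ b, q b = x) :
    ∃ (y : Fin n → B) (h : B), 0 ≤ h ∧ q h = x ∧ (∀ i, q (y i) = V i * x) ∧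
      ∀ i j, star (y i) * y j = if i = j then h * h else 0 := by
  choose L hL using hVr
  obtain ⟨p₀, hp₀⟩ := hPr
  obtain ⟨r₀, hr₀⟩ := hxr
  obtain ⟨w, hw, hwo⟩ := orth_lift q P V L hL hV hVP
  obtain ⟨r, s, hs0, hqs, hr⟩ := equalise q P hP hPs p₀ hp₀ w
    (fun i => by rw [map_mul, map_star, hw, hV, if_pos rfl]) Finset.univ
  have hss : star s = s := (IsSelfAdjoint.of_nonneg hs0).star_eq
  have hb0 : 0 ≤ star (s * r₀) * (s * r₀) := star_mul_self_nonneg _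
  refine ⟨fun i => w i * r i * r₀, CFC.sqrt (star (s * r₀) * (s * r₀)), CFC.sqrt_nonneg _, ?_, ?_,
    ?_⟩
  · have h1 : 0 ≤ q (CFC.sqrt (star (s * r₀) * (s * r₀))) := starHom_nonneg q (CFC.sqrt_nonneg _)
    have hxs : star x = x := (IsSelfAdjoint.of_nonneg hx).star_eq
    have h2 : q (CFC.sqrt (star (s * r₀) * (s * r₀))) * q (CFC.sqrt (star (s * r₀) * (s * r₀)))
        = x * x := by
      rw [← map_mul, CFC.sqrt_mul_sqrt_self _ hb0, map_mul, map_star, map_mul, hqs, hr₀, hPx, hxs]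
    rw [← CFC.sqrt_unique h2 h1]
    exact CFC.sqrt_unique rfl hx
  · intro i
    rw [map_mul, map_mul, hw, (hr i (Finset.mem_univ i)).1, hr₀, hVP]
  · intro i j
    rw [CFC.sqrt_mul_sqrt_self _ hb0]
    split_ifs with hij
    · subst hij
      calc star (w i * r i * r₀) * (w i * r i * r₀)
          = star r₀ * (star (r i) * (star (w i) * w i) * r i) * r₀ := by
            simp only [star_mul, mul_assoc]
        _ = _ := by
          rw [(hr i (Finset.mem_univ i)).2]
          simp only [star_mul, mul_assoc, hss]
    · calc star (w i * r i * r₀) * (w j * r j * r₀)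
          = star r₀ * (star (r i) * (star (w i) * w j) * r j) * r₀ := by
            simp only [star_mul, mul_assoc]
        _ = _ := by rw [hwo i j hij]; simp


lemma unif_small {α : Type*} (S : Set α) (F : α → ℂ) (d : α → ℝ) (hd : ∀ z, 0 ≤ d z) (C : ℝ)
    (hC : ∀ z ∈ S, ‖F z‖ ≤ C) (hF : ∀ ε > 0, ∃ δ > 0, ∀ z ∈ S, d z < δ → ‖F z‖ < ε)
    (ε : ℝ) (hε : 0 < ε) : ∀ᶠ m : ℕ in atTop, ∀ z ∈ S, ‖F z‖ / (1 + m * d z) < ε := by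
  obtain ⟨δ, hδ, h⟩ := hF ε hε
  have h1 : Tendsto (fun m : ℕ => (m : ℝ) * (δ * ε)) atTop atTop :=
    tendsto_natCast_atTop_atTop.atTop_mul_const (by positivity)
  filter_upwards [h1.eventually_gt_atTop C] with m hm z hz
  have hpos : 0 < 1 + m * d z := by have := hd z; positivity
  rw [div_lt_iff₀ hpos]
  rcases lt_or_ge (d z) δ with h2 | h2
  · have h3 := h z hz h2
    have : 0 ≤ (m : ℝ) * d z := by have := hd z; positivity
    nlinarith
  · have h3 := hC z hz
    have h4 : (m : ℝ) * (δ * ε) ≤ m * (d z * ε) := by gcongr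
    nlinarith

lemma exists_gm {B : Type*} [NonUnitalCStarAlgebra B] (h : B) (hn : IsStarNormal h) :
    ∃ g : ℕ → B, (∀ m, h * g m = g m * h) ∧ (∀ m, star (h * g m) = h * g m) ∧
      (∀ m, ‖h * g m‖ ≤ 1) ∧ ∀ F : ℂ → ℂ, Continuous F → F 0 = 0 →
        Tendsto (fun m => h * g m * cfcₙ F h) atTop (𝓝 (cfcₙ F h)) ∧
        Tendsto (fun m => cfcₙ F h * (h * g m)) atTop (𝓝 (cfcₙ F h)) := by
  let G : ℕ → ℂ → ℂ := fun m z => (m : ℂ) * star z / (1 + m * ‖z‖ ^ 2 : ℝ)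
  have hden : ∀ (m : ℕ) (z : ℂ), ((1 + m * ‖z‖ ^ 2 : ℝ) : ℂ) ≠ 0 := by
    intro m z
    have : (0:ℝ) < 1 + m * ‖z‖ ^ 2 := by positivity
    exact_mod_cast this.ne'
  have hGc : ∀ m, Continuous (G m) := by
    intro m
    refine Continuous.div (by fun_prop) (by fun_prop) (hden m)
  have hG0 : ∀ m, G m 0 = 0 := by intro m; simp [G]
  have hzG : ∀ m z, z * G m z = ((m * ‖z‖ ^ 2 / (1 + m * ‖z‖ ^ 2) : ℝ) : ℂ) := by
    intro m z
    have : z * star z = ((‖z‖ ^ 2 : ℝ) : ℂ) := by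
      have := Complex.mul_conj' z
      simpa using this
    simp only [G]
    rw [mul_div_assoc', mul_left_comm, this]
    push_cast; rfl
  have hhG : ∀ m, h * cfcₙ (G m) h = cfcₙ (fun z => z * G m z) h := by
    intro m
    rw [cfcₙ_mul (fun z => z) (G m) h (by fun_prop) rfl (hGc m).continuousOn (hG0 m), cfcₙ_id' ℂ h]
  have hcomm : ∀ F : ℂ → ℂ, ∀ m, h * cfcₙ (G m) h * cfcₙ F h = cfcₙ F h * (h * cfcₙ (G m) h) := by
    intro F m
    rw [hhG]
    exact cfcₙ_commute_cfcₙ _ _ h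
  refine ⟨fun m => cfcₙ (G m) h, fun m => ?_, fun m => ?_, fun m => ?_, fun F hF hF0 => ?_⟩
  · have := cfcₙ_commute_cfcₙ (fun z : ℂ => z) (G m) h
    rw [cfcₙ_id' ℂ h] at this
    exact this
  · rw [hhG, ← cfcₙ_star]
    congr 1
    funext z
    rw [hzG]
    simp
  · rw [hhG]
    refine norm_cfcₙ_le fun z _ => ?_
    rw [hzG, Complex.norm_real, Real.norm_of_nonneg (by positivity), div_le_one (by positivity)]
    linarith
  · have h1 : Tendsto (fun m => h * cfcₙ (G m) h * cfcₙ F h) atTop (𝓝 (cfcₙ F h)) := by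
      have e1 : (fun m => h * cfcₙ (G m) h * cfcₙ F h)
          = fun m => cfcₙ (fun z => (z * G m z) * F z) h := by
        funext m
        rw [hhG, cfcₙ_mul _ F h (by have := hGc m; fun_prop) (by simp) hF.continuousOn hF0]
      rw [e1]
      have hK : IsCompact (quasispectrum ℂ h) := quasispectrum.isCompact h
      obtain ⟨C, hC⟩ := hK.exists_bound_of_continuousOn hF.continuousOn
      refine tendsto_cfcₙ_fun ?_ (Eventually.of_forall fun m => ?_)
        (Eventually.of_forall fun m => by simp)
      · rw [Metric.tendstoUniformlyOn_iff]
        intro ε hε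
        have := unif_small (quasispectrum ℂ h) F (fun z => ‖z‖ ^ 2) (fun z => by positivity) C hC ?_ ε hε
        · filter_upwards [this] with m hm z hz
          refine lt_of_le_of_lt (le_of_eq ?_) (hm z hz)
          rw [dist_eq_norm, hzG]
          have h3 : F z - ((m * ‖z‖ ^ 2 / (1 + m * ‖z‖ ^ 2) : ℝ) : ℂ) * F z
              = F z / ((1 + m * ‖z‖ ^ 2 : ℝ) : ℂ) := by
            have := hden m z
            push_cast at this ⊢
            field_simp
            ring
          rw [h3, norm_div, Complex.norm_real, Real.norm_of_nonneg (by positivity)]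
        · intro ε hε
          obtain ⟨δ, hδ, hh⟩ := Metric.continuousAt_iff.1 (hF.continuousAt (x := 0)) ε hε
          refine ⟨δ ^ 2, by positivity, fun z _ hz => ?_⟩
          have := hh (x := z) (by
            rw [dist_zero_right]
            exact lt_of_pow_lt_pow_left₀ 2 hδ.le hz)
          rwa [hF0, dist_zero_right] at this
      · have := hGc m
        exact Continuous.continuousOn (by fun_prop)
    refine ⟨h1, ?_⟩
    simpa only [hcomm] using h1

lemma norm_sandwich {B : Type*} [NonUnitalCStarAlgebra B] (y y' h a : B) (hs : star h = h)
    (hy : star y * y = h * h) (hy' : star y' * y' = h * h) :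
    ‖y * a * star y'‖ = ‖h * a * h‖ := by
  have h1 : ‖y * a * star y'‖ = ‖h * a * star y'‖ := by
    have : ‖y * a * star y'‖ * ‖y * a * star y'‖ = ‖h * a * star y'‖ * ‖h * a * star y'‖ := by
      rw [← CStarRing.norm_star_mul_self, ← CStarRing.norm_star_mul_self]
      congr 1
      calc star (y * a * star y') * (y * a * star y')
          = y' * (star a * (star y * y) * a) * star y' := by simp [mul_assoc]
        _ = _ := by rw [hy]; simp [mul_assoc, hs]
    exact (mul_self_inj (norm_nonneg _) (norm_nonneg _)).1 this
  have h2 : ‖h * a * star y'‖ = ‖h * a * h‖ := by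
    have : ‖h * a * star y'‖ * ‖h * a * star y'‖ = ‖h * a * h‖ * ‖h * a * h‖ := by
      rw [← CStarRing.norm_self_mul_star, ← CStarRing.norm_self_mul_star]
      congr 1
      calc h * a * star y' * star (h * a * star y')
          = h * a * (star y' * y') * star a * h := by simp [mul_assoc, hs]
        _ = _ := by rw [hy']; simp [mul_assoc, hs]
    exact (mul_self_inj (norm_nonneg _) (norm_nonneg _)).1 this
  rw [h1, h2]

lemma sum_sum_mul {n : ℕ} {B : Type*} [NonUnitalRing B] (a b : Fin n → Fin n → B) :
    (∑ i, ∑ j, a i j) * (∑ k, ∑ l, b k l) = ∑ i, ∑ l, ∑ j, ∑ k, a i j * b k l := by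
  rw [Finset.sum_mul]
  refine Finset.sum_congr rfl fun i _ => ?_
  rw [Finset.sum_comm (f := fun k l => b k l), Finset.mul_sum]
  refine Finset.sum_congr rfl fun l _ => ?_
  rw [Finset.sum_mul]
  refine Finset.sum_congr rfl fun j _ => ?_
  rw [Finset.mul_sum]

lemma exists_psi {n : ℕ} {A B : Type*} [NonUnitalRing A] [StarRing A] [Module ℂ A]
    [NonUnitalCStarAlgebra B] (α : A →⋆ₙₐ[ℂ] B) (y : Fin n → B) (h : B) (g : ℕ → B)
    (hs : star h = h) (hy : ∀ i j, star (y i) * y j = if i = j then h * h else 0)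
    (hg2 : ∀ m, star (h * g m) = h * g m)
    (hg3 : ∀ m, ‖h * g m‖ ≤ 1)
    (hα1 : ∀ f, Tendsto (fun m => h * g m * α f) atTop (𝓝 (α f)))
    (hα2 : ∀ f, Tendsto (fun m => α f * (h * g m)) atTop (𝓝 (α f))) :
    ∃ ψ : Matrix (Fin n) (Fin n) A →⋆ₙₐ[ℂ] B, ∀ f,
      Tendsto (fun m => ∑ i, ∑ j, y i * (g m * α (f i j) * star (g m)) * star (y j)) atTop
        (𝓝 (ψ f)) := by
  have hg4 : ∀ m, star (g m) * h = h * g m := by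
    intro m
    have := hg2 m
    rwa [star_mul, hs] at this
  have hsand : ∀ m i j a, ‖y i * (g m * a * star (g m)) * star (y j)‖ ≤ ‖a‖ := by
    intro m i j a
    rw [norm_sandwich (y i) (y j) h _ hs (by rw [hy, if_pos rfl]) (by rw [hy, if_pos rfl])]
    calc ‖h * (g m * a * star (g m)) * h‖ = ‖(h * g m) * a * (star (g m) * h)‖ := by
          simp only [mul_assoc]
      _ = ‖(h * g m) * a * (h * g m)‖ := by rw [hg4]
      _ ≤ ‖h * g m‖ * ‖a‖ * ‖h * g m‖ := (norm_mul_le _ _).trans (by gcongr; exact norm_mul_le _ _)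
      _ ≤ 1 * ‖a‖ * 1 := by gcongr <;> exact hg3 m
      _ = ‖a‖ := by ring
  -- convergence of `e a e`
  have heae : ∀ f, Tendsto (fun m => (h * g m) * α f * (h * g m)) atTop (𝓝 (α f)) := by
    intro f
    have h1 : Tendsto (fun m => (h * g m * α f - α f) * (h * g m) + α f * (h * g m)) atTop
        (𝓝 (0 + α f)) := by
      refine Tendsto.add ?_ (hα2 f)
      refine squeeze_zero_norm (a := fun m => ‖h * g m * α f - α f‖) (fun m => ?_) ?_
      · calc ‖(h * g m * α f - α f) * (h * g m)‖ ≤ ‖h * g m * α f - α f‖ * ‖h * g m‖ :=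
              norm_mul_le _ _
          _ ≤ ‖h * g m * α f - α f‖ * 1 := by gcongr; exact hg3 m
          _ = _ := mul_one _
      · exact (tendsto_iff_norm_sub_tendsto_zero.1 (hα1 f))
    rw [zero_add] at h1
    refine h1.congr fun m => ?_
    rw [sub_mul, sub_add_cancel]
  have hconv : ∀ i j f, ∃ b, Tendsto (fun m => y i * (g m * α f * star (g m)) * star (y j)) atTop
      (𝓝 b) := by
    intro i j f
    apply cauchySeq_tendsto_of_complete
    have hc := (heae f).cauchySeq
    rw [Metric.cauchySeq_iff] at hc ⊢
    intro ε hε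
    obtain ⟨N, hN⟩ := hc ε hε
    refine ⟨N, fun m hm l hl => ?_⟩
    have := hN m hm l hl
    rw [dist_eq_norm] at this ⊢
    rw [← sub_mul, ← mul_sub, norm_sandwich (y i) (y j) h _ hs (by rw [hy, if_pos rfl])
      (by rw [hy, if_pos rfl])]
    refine lt_of_le_of_lt (le_of_eq ?_) this
    congr 1
    rw [mul_sub, sub_mul]
    congr 1
    · calc h * (g m * α f * star (g m)) * h = (h * g m) * α f * (star (g m) * h) := by
            simp only [mul_assoc]
        _ = _ := by rw [hg4]
    · calc h * (g l * α f * star (g l)) * h = (h * g l) * α f * (star (g l) * h) := by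
            simp only [mul_assoc]
        _ = _ := by rw [hg4]
  choose T hT using hconv
  let S : ℕ → Matrix (Fin n) (Fin n) A → B := fun m f =>
    ∑ i, ∑ j, y i * (g m * α (f i j) * star (g m)) * star (y j)
  let Ψ : Matrix (Fin n) (Fin n) A → B := fun f => ∑ i, ∑ j, T i j (f i j)
  have hΨ : ∀ f, Tendsto (fun m => S m f) atTop (𝓝 (Ψ f)) := fun f =>
    tendsto_finsetSum _ fun i _ => tendsto_finsetSum _ fun j _ => hT i j (f i j)
  have hmul : ∀ f f' : Matrix (Fin n) (Fin n) A,
      Tendsto (fun m => S m f * S m f' - S m (f * f')) atTop (𝓝 0) := by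
    intro f f'
    have hterm : ∀ m, S m f * S m f' - S m (f * f') = ∑ i, ∑ l, ∑ j,
        y i * (g m * (α (f i j) * (h * g m) * ((h * g m) * α (f' j l)) - α (f i j) * α (f' j l))
          * star (g m)) * star (y l) := by
      intro m
      have e1 : S m f * S m f' = ∑ i, ∑ l, ∑ j,
          y i * (g m * (α (f i j) * (h * g m) * ((h * g m) * α (f' j l))) * star (g m))
            * star (y l) := by
        have key : ∀ i j k l, y i * (g m * α (f i j) * star (g m)) * star (y j) *
            (y k * (g m * α (f' k l) * star (g m)) * star (y l)) = if j = k then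
            y i * (g m * (α (f i j) * (h * g m) * ((h * g m) * α (f' k l))) * star (g m))
            * star (y l) else 0 := by
          intro i j k l
          have : y i * (g m * α (f i j) * star (g m)) * star (y j) *
            (y k * (g m * α (f' k l) * star (g m)) * star (y l)) =
            y i * (g m * α (f i j) * (star (g m) * (star (y j) * y k) * g m) * α (f' k l)
              * star (g m)) * star (y l) := by simp only [mul_assoc]
          rw [this, hy]
          split_ifs with hjk
          · have : star (g m) * (h * h) * g m = (h * g m) * (h * g m) := by
              rw [← mul_assoc, hg4, mul_assoc]
            rw [this]; simp only [mul_assoc]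
          · simp
        simp only [S]
        rw [sum_sum_mul]
        simp only [key]
        simp
      have e2 : S m (f * f') = ∑ i, ∑ l, ∑ j,
          y i * (g m * (α (f i j) * α (f' j l)) * star (g m)) * star (y l) := by
        simp only [S, Matrix.mul_apply, map_sum, map_mul, Finset.mul_sum, Finset.sum_mul]
      rw [e1, e2, ← Finset.sum_sub_distrib]
      refine Finset.sum_congr rfl fun i _ => ?_
      rw [← Finset.sum_sub_distrib]
      refine Finset.sum_congr rfl fun l _ => ?_
      rw [← Finset.sum_sub_distrib]
      refine Finset.sum_congr rfl fun j _ => ?_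
      rw [← sub_mul, ← mul_sub, ← sub_mul, ← mul_sub]
    simp only [hterm]
    have hz : (0 : B) = ∑ _i : Fin n, ∑ _l : Fin n, ∑ _j : Fin n, (0 : B) := by simp
    rw [hz]
    refine tendsto_finsetSum _ fun i _ => tendsto_finsetSum _ fun l _ =>
      tendsto_finsetSum _ fun j _ => ?_
    refine squeeze_zero_norm (fun m => hsand m i l _) ?_
    have := (hα2 (f i j)).mul (hα1 (f' j l))
    exact tendsto_iff_norm_sub_tendsto_zero.1 this
  refine ⟨{ toFun := Ψ, map_smul' := ?_, map_zero' := ?_, map_add' := ?_, map_mul' := ?_,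
            map_star' := ?_ }, hΨ⟩
  · intro c f
    refine tendsto_nhds_unique (hΨ (c • f)) ?_
    refine ((hΨ f).const_smul c).congr fun m => ?_
    simp [S, Finset.smul_sum, mul_smul_comm, smul_mul_assoc]
  · refine tendsto_nhds_unique (hΨ 0) ?_
    simp [S]
  · intro f f'
    refine tendsto_nhds_unique (hΨ (f + f')) ?_
    refine ((hΨ f).add (hΨ f')).congr fun m => ?_
    simp [S, mul_add, add_mul, Finset.sum_add_distrib]
  · intro f f'
    refine tendsto_nhds_unique (hΨ (f * f')) ?_
    have := ((hΨ f).mul (hΨ f')).sub (hmul f f')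
    rw [sub_zero] at this
    refine this.congr fun m => ?_
    rw [sub_sub_cancel]
  · intro f
    refine tendsto_nhds_unique (hΨ (star f)) ?_
    refine ((hΨ f).star).congr fun m => ?_
    simp only [S, star_sum, Matrix.star_apply, map_star]
    rw [Finset.sum_comm]
    refine Finset.sum_congr rfl fun i _ => Finset.sum_congr rfl fun j _ => ?_
    simp [mul_assoc]


section Ext
variable {K : Type*} [MetricSpace K] [CompactSpace K] (x₀ : K)

/-- restriction of a function vanishing at `x₀` -/
noncomputable def restr0 (F : K → ℂ) (hF : Continuous F) (h0 : F x₀ = 0) :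
    ZeroAtInftyContinuousMap {x : K // x ≠ x₀} ℂ where
  toFun := fun x => F x
  continuous_toFun := hF.comp continuous_subtype_val
  zero_at_infty' := by
    rw [Metric.tendsto_nhds]
    intro ε hε
    have hc : IsCompact {x : K | ε ≤ dist (F x) 0} :=
      (isClosed_le continuous_const (by fun_prop)).isCompact
    have hc' : IsCompact ((Subtype.val : {x : K // x ≠ x₀} → K) ⁻¹' {x : K | ε ≤ dist (F x) 0}) := by
      rw [Subtype.isCompact_iff]
      convert hc using 1
      rw [Set.image_preimage_eq_iff]
      intro x hx
      refine ⟨⟨x, ?_⟩, rfl⟩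
      rintro rfl
      simp only [Set.mem_setOf_eq] at hx
      rw [h0, dist_self] at hx
      linarith
    filter_upwards [hc'.compl_mem_cocompact] with x hx
    simpa using hx

open Classical in
/-- extension by zero -/
noncomputable def ext0 (f : ZeroAtInftyContinuousMap {x : K // x ≠ x₀} ℂ) (x : K) : ℂ :=
  if h : x = x₀ then 0 else f ⟨x, h⟩

@[simp] lemma ext0_self (f : ZeroAtInftyContinuousMap {x : K // x ≠ x₀} ℂ) : ext0 x₀ f x₀ = 0 := by
  simp [ext0]

@[simp] lemma ext0_coe (f : ZeroAtInftyContinuousMap {x : K // x ≠ x₀} ℂ) (x : {x : K // x ≠ x₀}) :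
    ext0 x₀ f x = f x := by
  simp [ext0, x.2]

lemma ext0_continuous (f : ZeroAtInftyContinuousMap {x : K // x ≠ x₀} ℂ) :
    Continuous (ext0 x₀ f) := by
  rw [continuous_iff_continuousAt]
  intro x
  by_cases hx : x = x₀
  · subst hx
    rw [ContinuousAt, ext0_self, Metric.tendsto_nhds]
    intro ε hε
    have h1 := (Metric.tendsto_nhds.1 f.zero_at_infty') ε hε
    rw [Filter.eventually_iff, mem_cocompact] at h1
    obtain ⟨C, hC, hCs⟩ := h1
    have h2 : IsClosed (Subtype.val '' C) := (hC.image continuous_subtype_val).isClosed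
    have h3 : (Subtype.val '' C)ᶜ ∈ 𝓝 x := h2.isOpen_compl.mem_nhds (by
      rintro ⟨z, _, hz⟩
      exact z.2 hz)
    filter_upwards [h3] with z hz
    by_cases hzx : z = x
    · subst hzx; simpa using hε
    · have : (⟨z, hzx⟩ : {y : K // y ≠ x}) ∈ Cᶜ := fun h => hz ⟨_, h, rfl⟩
      have := hCs this
      simpa [ext0, hzx] using this
  · have hop : IsOpen {y : K | y ≠ x₀} := isOpen_ne
    have hoe : IsOpenEmbedding (Subtype.val : {y : K // y ≠ x₀} → K) := hop.isOpenEmbedding_subtypeVal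
    have := hoe.continuousAt_iff (g := ext0 x₀ f) (x := ⟨x, hx⟩)
    refine this.1 ?_
    have e : ext0 x₀ f ∘ Subtype.val = f := by funext z; simp
    rw [e]
    exact f.continuous_toFun.continuousAt

lemma ext0_add (f f' : ZeroAtInftyContinuousMap {x : K // x ≠ x₀} ℂ) (x : K) :
    ext0 x₀ (f + f') x = ext0 x₀ f x + ext0 x₀ f' x := by
  by_cases h : x = x₀ <;> simp [ext0, h]
lemma ext0_mul (f f' : ZeroAtInftyContinuousMap {x : K // x ≠ x₀} ℂ) (x : K) :
    ext0 x₀ (f * f') x = ext0 x₀ f x * ext0 x₀ f' x := by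
  by_cases h : x = x₀ <;> simp [ext0, h]
lemma ext0_smul (c : ℂ) (f : ZeroAtInftyContinuousMap {x : K // x ≠ x₀} ℂ) (x : K) :
    ext0 x₀ (c • f) x = c * ext0 x₀ f x := by
  by_cases h : x = x₀ <;> simp [ext0, h]
lemma ext0_star (f : ZeroAtInftyContinuousMap {x : K // x ≠ x₀} ℂ) (x : K) :
    ext0 x₀ (star f) x = star (ext0 x₀ f x) := by
  by_cases h : x = x₀ <;> simp [ext0, h]
lemma ext0_zero (x : K) : ext0 x₀ 0 x = 0 := by
  by_cases h : x = x₀ <;> simp [ext0, h]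

/-- the functional calculus homomorphism attached to a path `γ` with `γ 0 = x₀` -/
noncomputable def alphaHom {B : Type*} [NonUnitalCStarAlgebra B] (γ : ℂ → K) (hγ : Continuous γ)
    (h0 : γ 0 = x₀) (h : B) (hn : IsStarNormal h) :
    ZeroAtInftyContinuousMap {x : K // x ≠ x₀} ℂ →⋆ₙₐ[ℂ] B where
  toFun f := cfcₙ (fun z => ext0 x₀ f (γ z)) h
  map_smul' c f := by
    simp only [ext0_smul]
    exact cfcₙ_const_mul c _ h ((ext0_continuous x₀ f).comp hγ).continuousOn (by simp [h0])
  map_zero' := by simp [ext0_zero]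
  map_add' f f' := by
    simp only [ext0_add]
    exact cfcₙ_add _ _ h ((ext0_continuous x₀ f).comp hγ).continuousOn (by simp [h0])
      ((ext0_continuous x₀ f').comp hγ).continuousOn (by simp [h0])
  map_mul' f f' := by
    simp only [ext0_mul]
    exact cfcₙ_mul _ _ h ((ext0_continuous x₀ f).comp hγ).continuousOn (by simp [h0])
      ((ext0_continuous x₀ f').comp hγ).continuousOn (by simp [h0])
  map_star' f := by
    simp only [ext0_star]
    exact cfcₙ_star _ h

/-- approximate unit -/
lemma exists_approx_unit : ∃ u : ℕ → ZeroAtInftyContinuousMap {x : K // x ≠ x₀} ℂ,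
    (∀ m, ‖u m‖ ≤ 1) ∧ (∀ m, star (u m) = u m) ∧
    (∀ l m, l ≤ m → ∃ s, u m - u l = (u m - u l) * (u m - u l) + star s * s) ∧
    (∀ l m, l ≤ m → ∃ s, u m - u l = star s * s) ∧
    ∀ f, Tendsto (fun m => u m * f) atTop (𝓝 f) := by
  let d : K → ℝ := fun x => dist x x₀
  let v : ℕ → K → ℝ := fun m x => m * d x / (1 + m * d x)
  have hd : ∀ x, 0 ≤ d x := fun x => dist_nonneg
  have hden : ∀ (m : ℕ) x, 0 < 1 + m * d x := fun m x => by have := hd x; positivity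
  have hvc : ∀ m, Continuous (v m) := fun m =>
    Continuous.div (by fun_prop) (by fun_prop) (fun x => (hden m x).ne')
  have hv0 : ∀ m, v m x₀ = 0 := fun m => by simp [v, d]
  have hvnn : ∀ m x, 0 ≤ v m x := fun m x => by have := hd x; positivity
  have hv1 : ∀ m x, v m x ≤ 1 := fun m x => by
    rw [div_le_one (hden m x)]; linarith
  have hmono : ∀ l m, l ≤ m → ∀ x, v l x ≤ v m x := by
    intro l m hlm x
    simp only [v]
    rw [div_le_div_iff₀ (hden l x) (hden m x)]
    have : (l : ℝ) * d x ≤ m * d x := by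
      have := hd x; gcongr
    nlinarith
  let u : ℕ → ZeroAtInftyContinuousMap {x : K // x ≠ x₀} ℂ := fun m =>
    restr0 x₀ (fun x => (v m x : ℂ)) (by have := hvc m; fun_prop) (by simp [hv0])
  have hu : ∀ m x, u m x = (v m x : ℂ) := fun m x => rfl
  refine ⟨u, fun m => ?_, fun m => ?_, fun l m hlm => ?_, fun l m hlm => ?_, fun f => ?_⟩
  · rw [← ZeroAtInftyContinuousMap.norm_toBCF_eq_norm, BoundedContinuousFunction.norm_le zero_le_one]
    intro x
    change ‖u m x‖ ≤ 1
    rw [hu, Complex.norm_real, Real.norm_of_nonneg (hvnn m x)]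
    exact hv1 m x
  · ext x
    simp [hu]
  · refine ⟨restr0 x₀ (fun x => ((Real.sqrt ((v m x - v l x) * (1 - (v m x - v l x))) : ℝ) : ℂ))
      (by have := hvc m; have := hvc l; fun_prop) (by simp [hv0]), ?_⟩
    ext x
    have h1 : 0 ≤ (v m x - v l x) * (1 - (v m x - v l x)) := by
      have := hmono l m hlm x
      have := hv1 m x
      have := hvnn l x
      apply mul_nonneg <;> linarith
    have h2 := Real.mul_self_sqrt h1
    simp only [ZeroAtInftyContinuousMap.sub_apply, ZeroAtInftyContinuousMap.add_apply,
      ZeroAtInftyContinuousMap.mul_apply, ZeroAtInftyContinuousMap.star_apply, hu, restr0,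
      ZeroAtInftyContinuousMap.coe_mk]
    have h3 : v m x - v l x = (v m x - v l x) * (v m x - v l x) +
      Real.sqrt ((v m x - v l x) * (1 - (v m x - v l x))) *
      Real.sqrt ((v m x - v l x) * (1 - (v m x - v l x))) := by rw [h2]; ring
    rw [Complex.star_def, Complex.conj_ofReal]
    exact_mod_cast h3
  · refine ⟨restr0 x₀ (fun x => ((Real.sqrt (v m x - v l x) : ℝ) : ℂ))
      (by have := hvc m; have := hvc l; fun_prop) (by simp [hv0]), ?_⟩
    ext x
    have h1 : 0 ≤ v m x - v l x := by
      have := hmono l m hlm x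
      linarith
    have h2 := Real.mul_self_sqrt h1
    simp only [ZeroAtInftyContinuousMap.sub_apply,
      ZeroAtInftyContinuousMap.mul_apply, ZeroAtInftyContinuousMap.star_apply, hu, restr0,
      ZeroAtInftyContinuousMap.coe_mk]
    rw [Complex.star_def, Complex.conj_ofReal]
    exact_mod_cast h2.symm
  · rw [Metric.tendsto_nhds]
    intro ε hε
    have hcomp := isCompact_univ (X := K)
    obtain ⟨C, hC⟩ := hcomp.exists_bound_of_continuousOn (ext0_continuous x₀ f).continuousOn
    have := unif_small Set.univ (ext0 x₀ f) d hd C hC (by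
      intro ε hε
      obtain ⟨δ, hδ, hh⟩ := Metric.continuousAt_iff.1
        ((ext0_continuous x₀ f).continuousAt (x := x₀)) ε hε
      refine ⟨δ, hδ, fun z _ hz => ?_⟩
      have := hh hz
      rwa [ext0_self, dist_zero_right] at this) (ε / 2) (by positivity)
    filter_upwards [this] with m hm
    refine lt_of_le_of_lt ?_ (half_lt_self hε)
    rw [dist_eq_norm, ← ZeroAtInftyContinuousMap.norm_toBCF_eq_norm,
      BoundedContinuousFunction.norm_le (by positivity)]
    intro x
    refine le_trans (le_of_eq ?_) (hm x (Set.mem_univ _)).le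
    change ‖u m x * f x - f x‖ = _
    rw [hu, ext0_coe]
    have h3 : ((v m x : ℝ) : ℂ) * f x - f x = - (f x / ((1 + m * d x : ℝ) : ℂ)) := by
      have h4 : ((1 + m * d x : ℝ) : ℂ) ≠ 0 := by exact_mod_cast (hden m x).ne'
      simp only [v]
      push_cast at h4 ⊢
      field_simp
      ring
    rw [h3, norm_neg, norm_div, Complex.norm_real, Real.norm_of_nonneg (hden m x).le]

end Ext


lemma extDisc_of_vN {X : Type*} [TopologicalSpace X] [CompactSpace X] [T2Space X]
    {H : Type*} [NormedAddCommGroup H] [InnerProductSpace ℂ H] [CompleteSpace H]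
    (N : VonNeumannAlgebra H) (J : C(X, ℂ) →⋆ₐ[ℂ] (H →L[ℂ] H)) (hJi : Function.Injective J)
    (hJ : ∀ T, T ∈ N ↔ ∃ c, J c = T) : ExtremallyDisconnected X := by
  constructor
  intro U hU
  let E : Submodule ℂ H :=
    (Submodule.span ℂ {η | ∃ (c : C(X, ℂ)) (ξ : H), (∀ x ∉ U, c x = 0) ∧ η = J c ξ}).topologicalClosure
  have hEc : IsClosed (E : Set H) := Submodule.isClosed_topologicalClosure _
  haveI : CompleteSpace E := hEc.completeSpace_coe
  have hEle : ∀ F : Submodule ℂ H, IsClosed (F : Set H) →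
      (∀ (c : C(X, ℂ)) (ξ : H), (∀ x ∉ U, c x = 0) → J c ξ ∈ F) → E ≤ F := by
    intro F hF h
    refine Submodule.topologicalClosure_minimal _ ?_ hF
    rw [Submodule.span_le]
    rintro η ⟨c, ξ, hc, rfl⟩
    exact h c ξ hc
  have hmemE : ∀ (c : C(X, ℂ)) (ξ : H), (∀ x ∉ U, c x = 0) → J c ξ ∈ E := fun c ξ hc =>
    Submodule.le_topologicalClosure _ (Submodule.subset_span ⟨c, ξ, hc, rfl⟩)
  let p : H →L[ℂ] H := E.starProjection
  have hp : IsStarProjection p := isStarProjection_starProjection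
  have hpN : p ∈ N := by
    rw [VonNeumannAlgebra.IsStarProjection.mem_iff hp]
    intro y hy
    have hr : p.range = E := Submodule.range_starProjection E
    rw [hr]
    rw [Module.End.mem_invtSubmodule]
    refine hEle _ ?_ ?_
    · exact hEc.preimage y.continuous
    · intro c ξ hc
      have := (VonNeumannAlgebra.mem_commutant_iff.1 hy) (J c) ((hJ _).2 ⟨c, rfl⟩)
      have h2 := congrArg (fun T : H →L[ℂ] H => T ξ) this
      change y (J c ξ) ∈ E
      have h3 : y (J c ξ) = J c (y ξ) := h2.symm
      rw [h3]
      exact hmemE c _ hc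
  obtain ⟨π, hπ⟩ := (hJ p).1 hpN
  have hππ : π * π = π := hJi (by rw [map_mul, hπ]; exact hp.isIdempotentElem)
  have h01 : ∀ x, π x = 0 ∨ π x = 1 := by
    intro x
    have h := congrArg (fun f : C(X, ℂ) => f x) hππ
    have h : π x * π x = π x := h
    have h' : π x * (π x - 1) = 0 := by rw [mul_sub, h]; ring
    rcases mul_eq_zero.1 h' with h | h
    · exact Or.inl h
    · exact Or.inr (sub_eq_zero.1 h)
  -- Urysohn
  have ury : ∀ (C : Set X) (x : X), IsClosed C → x ∉ C → ∃ c : C(X, ℂ), c x = 1 ∧ ∀ z ∈ C, c z = 0 := by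
    intro C x hC hx
    obtain ⟨f, f0, f1, -⟩ := exists_continuous_zero_one_of_isClosed hC (isClosed_singleton (x := x))
      (Set.disjoint_singleton_right.2 hx)
    refine ⟨⟨fun z => (f z : ℂ), by fun_prop⟩, ?_, ?_⟩
    · have : f x = 1 := f1 rfl
      simp [this]
    · intro z hz
      have : f z = 0 := f0 hz
      simp [this]
  have hcl : closure U = {x | π x ≠ 0} := by
    apply Set.Subset.antisymm
    · have hclosed : IsClosed {x | π x ≠ 0} := by
        have : {x | π x ≠ 0} = {x | π x = 1} := by
          ext x
          rcases h01 x with h | h <;> simp [h]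
        rw [this]
        exact isClosed_eq π.continuous continuous_const
      refine closure_minimal ?_ hclosed
      intro x hx
      obtain ⟨c, hc1, hc0⟩ := ury Uᶜ x hU.isClosed_compl (by simpa using hx)
      have h1 : π * c = c := by
        apply hJi
        rw [map_mul, hπ]
        ext ξ
        exact Submodule.starProjection_eq_self_iff.2 (hmemE c ξ (fun z hz => hc0 z hz))
      have h2 : π x * c x = c x := congrArg (fun f : C(X, ℂ) => f x) h1
      rw [hc1, mul_one] at h2
      simp [h2]
    · intro x hx
      by_contra hxU
      obtain ⟨c, hc1, hc0⟩ := ury (closure U) x isClosed_closure hxU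
      have h1 : c * π = 0 := by
        apply hJi
        rw [map_mul, hπ, map_zero]
        ext ξ
        have hle : E ≤ (J c).ker := by
          refine hEle _ (ContinuousLinearMap.isClosed_ker _) ?_
          intro c' η hc'
          have : c * c' = 0 := by
            ext z
            by_cases hz : z ∈ U
            · simp [hc0 z (subset_closure hz)]
            · simp [hc' z hz]
          have h3 : J c (J c' η) = (J (c * c')) η := by rw [map_mul]; rfl
          change J c (J c' η) = 0
          rw [h3, this, map_zero]; rfl
        exact hle (Submodule.starProjection_apply_mem E ξ)
      have h2 : c x * π x = 0 := congrArg (fun f : C(X, ℂ) => f x) h1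
      rw [hc1, one_mul] at h2
      exact hx h2
  rw [hcl]
  exact isOpen_ne_fun π.continuous continuous_const

universe uX uK uY uW

lemma extDisc_ulift {X : Type uX} [TopologicalSpace X] [ExtremallyDisconnected X] :
    ExtremallyDisconnected (ULift.{uW, uX} X) := by
  constructor
  intro U hU
  have h1 : IsOpen (closure (ULift.up ⁻¹' U : Set X)) :=
    ExtremallyDisconnected.open_closure _ (hU.preimage Homeomorph.ulift.symm.continuous)
  have h2 := Homeomorph.ulift.symm.preimage_closure U (X := X)
  have h3 : IsOpen ((Homeomorph.ulift.symm : X → ULift.{uW, uX} X) ⁻¹' closure U) := by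
    rw [h2]; exact h1
  exact (Homeomorph.ulift.symm.isOpen_preimage).1 h3

lemma gleason_lift {X : Type uX} [TopologicalSpace X] [CompactSpace X] [T2Space X]
    [ExtremallyDisconnected X] {K : Type uK} [TopologicalSpace K] [CompactSpace K] [T2Space K]
    {Y : Type uY} [TopologicalSpace Y] [CompactSpace Y] [T2Space Y]
    (h : X → K) (hh : Continuous h) (g : Y → K) (hg : Continuous g) (hgs : Function.Surjective g) :
    ∃ k : X → Y, Continuous k ∧ ∀ x, g (k x) = h x := by
  haveI : ExtremallyDisconnected (ULift.{max uK uY, uX} X) := extDisc_ulift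
  have hp : CompactT2.Projective (ULift.{max uK uY, uX} X) :=
    CompactT2.ExtremallyDisconnected.projective
  obtain ⟨k, hk, hk2⟩ := @hp (ULift.{max uX uK, uY} Y) (ULift.{max uX uY, uK} K) _ _ _ _ _ _
    (fun x => ULift.up (h x.down)) (fun y => ULift.up (g y.down))
    (continuous_uliftUp.comp (hh.comp continuous_uliftDown))
    (continuous_uliftUp.comp (hg.comp continuous_uliftDown))
    (fun z => by
      obtain ⟨y, hy⟩ := hgs z.down
      exact ⟨ULift.up y, by simp [hy]⟩)
  refine ⟨fun x => (k (ULift.up x)).down,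
    continuous_uliftDown.comp (hk.comp continuous_uliftUp), fun x => ?_⟩
  have := congrFun hk2 (ULift.up x)
  exact congrArg ULift.down this

section GetX
variable {K : Type*} [MetricSpace K] [CompactSpace K] (x₀ : K)

/-- the unitization of `ρ` -/
noncomputable def unitHom {A : Type*} [CStarAlgebra A]
    (ρ : ZeroAtInftyContinuousMap {x : K // x ≠ x₀} ℂ →⋆ₙₐ[ℂ] A) : C(K, ℂ) →⋆ₐ[ℂ] A where
  toFun F := ρ (restr0 x₀ (fun z => F z - F x₀) (by fun_prop) (by simp)) + F x₀ • 1
  map_one' := by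
    have : restr0 x₀ (fun z => (1 : C(K, ℂ)) z - (1 : C(K, ℂ)) x₀) (by fun_prop) (by simp) = 0 := by
      ext z; simp [restr0]
    rw [this]; simp
  map_mul' F G := by
    have : restr0 x₀ (fun z => (F * G) z - (F * G) x₀) (by fun_prop) (by simp) =
        restr0 x₀ (fun z => F z - F x₀) (by fun_prop) (by simp) *
          restr0 x₀ (fun z => G z - G x₀) (by fun_prop) (by simp) +
        F x₀ • restr0 x₀ (fun z => G z - G x₀) (by fun_prop) (by simp) +
        G x₀ • restr0 x₀ (fun z => F z - F x₀) (by fun_prop) (by simp) := by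
      ext z; simp [restr0]; ring
    rw [this]
    simp only [map_add, map_mul, map_smul, mul_add, add_mul, ContinuousMap.mul_apply,
      smul_mul_assoc, mul_smul_comm, one_mul, mul_one, smul_smul]
    generalize ρ (restr0 x₀ (fun z => F z - F x₀) _ _) = a
    generalize ρ (restr0 x₀ (fun z => G z - G x₀) _ _) = b
    rw [smul_add, smul_smul, mul_comm (F x₀) (G x₀)]
    abel
  map_zero' := by
    have : restr0 x₀ (fun z => (0 : C(K, ℂ)) z - (0 : C(K, ℂ)) x₀) (by fun_prop) (by simp) = 0 := by
      ext z; simp [restr0]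
    rw [this]; simp
  map_add' F G := by
    have : restr0 x₀ (fun z => (F + G) z - (F + G) x₀) (by fun_prop) (by simp) =
        restr0 x₀ (fun z => F z - F x₀) (by fun_prop) (by simp) +
        restr0 x₀ (fun z => G z - G x₀) (by fun_prop) (by simp) := by
      ext z; simp [restr0]; ring
    rw [this, map_add]
    simp only [ContinuousMap.add_apply, add_smul]
    abel
  commutes' c := by
    have : restr0 x₀ (fun z => (algebraMap ℂ C(K, ℂ) c) z - (algebraMap ℂ C(K, ℂ) c) x₀)
        (by fun_prop) (by simp) = 0 := by
      ext z; simp [restr0]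
    rw [this]; simp [Algebra.algebraMap_eq_smul_one]
  map_star' F := by
    have : restr0 x₀ (fun z => (star F) z - (star F) x₀) (by fun_prop) (by simp) =
        star (restr0 x₀ (fun z => F z - F x₀) (by fun_prop) (by simp)) := by
      ext z; simp [restr0]
    rw [this]
    simp [map_star]

lemma unitHom_ext0 {A : Type*} [CStarAlgebra A]
    (ρ : ZeroAtInftyContinuousMap {x : K // x ≠ x₀} ℂ →⋆ₙₐ[ℂ] A) (f) :
    unitHom x₀ ρ ⟨ext0 x₀ f, ext0_continuous x₀ f⟩ = ρ f := by
  have : restr0 x₀ (fun z => (⟨ext0 x₀ f, ext0_continuous x₀ f⟩ : C(K, ℂ)) z -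
      (⟨ext0 x₀ f, ext0_continuous x₀ f⟩ : C(K, ℂ)) x₀) (by fun_prop) (by simp) = f := by
    ext z; simp [restr0]
  change ρ (restr0 x₀ (fun z => (⟨ext0 x₀ f, ext0_continuous x₀ f⟩ : C(K, ℂ)) z -
      (⟨ext0 x₀ f, ext0_continuous x₀ f⟩ : C(K, ℂ)) x₀) (by fun_prop) (by simp)) +
      (⟨ext0 x₀ f, ext0_continuous x₀ f⟩ : C(K, ℂ)) x₀ • 1 = ρ f
  rw [this]
  simp

/-- A path lift for commutative von Neumann algebras. -/
lemma gelfand_path {H : Type uW} [NormedAddCommGroup H] [InnerProductSpace ℂ H] [CompleteSpace H]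
    (ρ : ZeroAtInftyContinuousMap {x : K // x ≠ x₀} ℂ →⋆ₙₐ[ℂ] (H →L[ℂ] H))
    {Y : Type*} [TopologicalSpace Y] [CompactSpace Y] [T2Space Y]
    (γ : Y → K) (hγ : Continuous γ) (hγs : Function.Surjective γ) :
    ∃ (X : Type uW) (_ : TopologicalSpace X) (_ : CompactSpace X) (_ : T2Space X)
      (J : C(X, ℂ) →⋆ₐ[ℂ] (H →L[ℂ] H)) (k : X → Y) (hk : Continuous k),
      (∀ c z, (∀ f, z * ρ f = ρ f * z) → z * J c = J c * z) ∧
      ∀ f, J ⟨fun x => ext0 x₀ f (γ (k x)), (ext0_continuous x₀ f).comp (hγ.comp hk)⟩ = ρ f := by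
  let C : Set (H →L[ℂ] H) := Set.centralizer (Set.range ρ)
  have hCs : star C = C := by
    have : star (Set.range ρ) = Set.range ρ := by
      ext T
      constructor
      · rintro ⟨f, hf⟩
        exact ⟨star f, by rw [map_star, hf, star_star]⟩
      · rintro ⟨f, rfl⟩
        exact ⟨star f, by rw [map_star]⟩
    ext T
    constructor
    · intro h
      have := Set.star_mem_centralizer' (s := Set.range ρ) ?_ h
      · rwa [star_star] at this
      · rintro _ ⟨f, rfl⟩
        exact ⟨star f, by rw [map_star]⟩
    · intro h
      refine Set.star_mem_centralizer' (s := Set.range ρ) ?_ h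
      rintro _ ⟨f, rfl⟩
      exact ⟨star f, by rw [map_star]⟩
  have hcoe : (StarSubalgebra.centralizer ℂ C : Set (H →L[ℂ] H)) = Set.centralizer C := by
    rw [StarSubalgebra.coe_centralizer, hCs, Set.union_self]
  let N : VonNeumannAlgebra H :=
    { toStarSubalgebra := StarSubalgebra.centralizer ℂ C
      centralizer_centralizer' := by
        change Set.centralizer (Set.centralizer (StarSubalgebra.centralizer ℂ C : Set (H →L[ℂ] H))) = (StarSubalgebra.centralizer ℂ C : Set (H →L[ℂ] H))
        rw [hcoe]; simp }
  let A := StarSubalgebra.centralizer ℂ C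
  have hAmem : ∀ T, T ∈ A ↔ ∀ z ∈ C, z * T = T * z := by
    intro T
    rw [← SetLike.mem_coe, hcoe]; rfl
  have hclosed : IsClosed (A : Set (H →L[ℂ] H)) := by
    rw [hcoe]; exact Set.isClosed_centralizer _
  have hρA : ∀ f, ρ f ∈ A := fun f => (hAmem _).2 fun z hz => (hz _ ⟨f, rfl⟩).symm
  have hAC : ∀ T ∈ A, T ∈ C := by
    intro T hT
    rintro _ ⟨f, rfl⟩
    refine (hAmem T).1 hT _ ?_
    rintro _ ⟨f', rfl⟩
    rw [← map_mul, ← map_mul, mul_comm]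
  have hcomm : ∀ a b : A, a * b = b * a := fun a b =>
    Subtype.ext ((hAmem _).1 b.2 _ (hAC _ a.2))
  letI : CommCStarAlgebra A :=
    { StarSubalgebra.cstarAlgebra A (h_closed := hclosed) with
      mul_comm := hcomm }
  let X : Type uW := WeakDual.characterSpace ℂ A
  let G : A ≃⋆ₐ[ℂ] C(X, ℂ) := gelfandStarTransform A
  let J : C(X, ℂ) →⋆ₐ[ℂ] (H →L[ℂ] H) := A.subtype.comp (G.symm : C(X, ℂ) →⋆ₐ[ℂ] A)
  have hJi : Function.Injective J := fun a b h => G.symm.injective (Subtype.ext h)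
  haveI : ExtremallyDisconnected X := by
    refine extDisc_of_vN N J hJi ?_
    intro T
    constructor
    · intro hT
      refine ⟨G ⟨T, hT⟩, ?_⟩
      change ((G.symm (G ⟨T, hT⟩) : A) : H →L[ℂ] H) = T
      rw [G.symm_apply_apply]
    · rintro ⟨c, rfl⟩
      exact (G.symm c).2
  let ρ' : ZeroAtInftyContinuousMap {x : K // x ≠ x₀} ℂ →⋆ₙₐ[ℂ] A :=
    { toFun := fun f => ⟨ρ f, hρA f⟩
      map_smul' := fun c f => Subtype.ext (map_smul ρ c f)
      map_zero' := Subtype.ext (map_zero ρ)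
      map_add' := fun a b => Subtype.ext (map_add ρ a b)
      map_mul' := fun a b => Subtype.ext (map_mul ρ a b)
      map_star' := fun a => Subtype.ext (map_star ρ a) }
  let π := unitHom x₀ ρ'
  let h : X → K := fun χ => (WeakDual.CharacterSpace.homeoEval K ℂ).symm
    (WeakDual.CharacterSpace.compContinuousMap π χ)
  have hh : Continuous h := by
    exact (Homeomorph.continuous _).comp (ContinuousMap.continuous _)
  have hh2 : ∀ (χ : X) F, χ (π F) = F (h χ) := by
    intro χ F
    have : WeakDual.CharacterSpace.homeoEval K ℂ (h χ) = WeakDual.CharacterSpace.compContinuousMap π χ :=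
      Homeomorph.apply_symm_apply _ _
    exact (DFunLike.congr_fun this F).symm
  obtain ⟨k, hk, hk2⟩ := gleason_lift h hh γ hγ hγs
  refine ⟨X, inferInstance, inferInstance, inferInstance, J, k, hk, ?_, ?_⟩
  · intro c z hz
    refine (hAmem _).1 (G.symm c).2 z ?_
    rintro _ ⟨f, rfl⟩
    exact (hz f).symm
  · intro f
    have : (⟨fun x => ext0 x₀ f (γ (k x)), (ext0_continuous x₀ f).comp (hγ.comp hk)⟩ : C(X, ℂ)) =
        G (ρ' f) := by
      ext χ
      change ext0 x₀ f (γ (k χ)) = χ (ρ' f)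
      rw [hk2, ← unitHom_ext0 x₀ ρ' f]
      exact (hh2 χ ⟨ext0 x₀ f, ext0_continuous x₀ f⟩).symm
    rw [this]
    change ((G.symm (G (ρ' f)) : A) : H →L[ℂ] H) = ρ f
    rw [G.symm_apply_apply]
    rfl

lemma get_x {H : Type*} [NormedAddCommGroup H] [InnerProductSpace ℂ H] [CompleteSpace H]
    (ρ : ZeroAtInftyContinuousMap {x : K // x ≠ x₀} ℂ →⋆ₙₐ[ℂ] (H →L[ℂ] H))
    (γ : Set.Icc (0 : ℝ) 1 → K) (hγ : Continuous γ) (hγs : Function.Surjective γ)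
    (hγ0 : γ 0 = x₀) (P : H →L[ℂ] H) (hP : P * P = P) (hPs : star P = P)
    (hPρ : ∀ f, P * ρ f = ρ f) :
    ∃ x : H →L[ℂ] H, 0 ≤ x ∧ P * x = x ∧
      (∀ z, (∀ f, z * ρ f = ρ f * z) → z * P = P * z → z * x = x * z) ∧
      ∀ f, cfcₙ (fun z : ℂ => ext0 x₀ f (γ (Set.projIcc 0 1 zero_le_one z.re))) x = ρ f := by
  obtain ⟨X, _, _, _, J, k, hk, hJc, hJ⟩ := gelfand_path x₀ ρ γ hγ hγs
  have hρP : ∀ f, ρ f * P = ρ f := by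
    intro f
    have := congrArg star (hPρ (star f))
    rwa [star_mul, hPs, ← map_star, star_star] at this
  have hPJ : ∀ c, P * J c = J c * P := fun c => hJc c P fun f => by rw [hPρ, hρP]
  let Θ : C(X, ℂ) →⋆ₙₐ[ℂ] (H →L[ℂ] H) :=
    { toFun := fun c => J c * P
      map_smul' := fun c f => by simp
      map_zero' := by simp
      map_add' := fun a b => by simp [add_mul]
      map_mul' := fun a b => by
        rw [map_mul, mul_assoc (J a) P, ← mul_assoc P, hPJ, mul_assoc (J b), hP, mul_assoc]
      map_star' := fun a => by
        rw [map_star, star_mul, hPs, ← map_star, hPJ] }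
  let κ : C(X, ℂ) := ⟨fun x => ((k x : ℝ) : ℂ), by fun_prop⟩
  have hκ : ∃ s : C(X, ℂ), κ = star s * s := by
    refine ⟨⟨fun x => ((Real.sqrt (k x : ℝ) : ℝ) : ℂ), by fun_prop⟩, ?_⟩
    ext x
    have := Real.mul_self_sqrt (k x).2.1
    simp only [κ, ContinuousMap.coe_mk, ContinuousMap.mul_apply, ContinuousMap.star_apply]
    rw [Complex.star_def, Complex.conj_ofReal, ← Complex.ofReal_mul, this]
  refine ⟨Θ κ, ?_, ?_, ?_, ?_⟩
  · obtain ⟨s, hs⟩ := hκ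
    rw [hs, map_mul, map_star]
    exact star_mul_self_nonneg _
  · change P * (J κ * P) = J κ * P
    rw [← mul_assoc, hPJ, mul_assoc, hP]
  · intro z hz hzP
    change z * (J κ * P) = J κ * P * z
    rw [← mul_assoc, hJc κ z hz, mul_assoc, hzP, mul_assoc]
  · intro f
    have hFc : Continuous (fun z : ℂ => ext0 x₀ f (γ (Set.projIcc 0 1 zero_le_one z.re))) :=
      (ext0_continuous x₀ f).comp (hγ.comp (continuous_projIcc.comp Complex.continuous_re))
    have hF0 : ext0 x₀ f (γ (Set.projIcc 0 1 zero_le_one (0 : ℂ).re)) = 0 := by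
      have : Set.projIcc (0 : ℝ) 1 zero_le_one (0 : ℂ).re = 0 := by
        rw [Complex.zero_re]; exact Set.projIcc_left zero_le_one
      rw [this, hγ0, ext0_self]
    have h1 : cfcₙ (fun z : ℂ => ext0 x₀ f (γ (Set.projIcc 0 1 zero_le_one z.re))) κ =
        ⟨fun x => ext0 x₀ f (γ (k x)), (ext0_continuous x₀ f).comp (hγ.comp hk)⟩ := by
      ext x
      rw [cfcn_cont_eval κ _ hFc hF0]
      change ext0 x₀ f (γ (Set.projIcc 0 1 zero_le_one (((k x : ℝ) : ℂ)).re)) = ext0 x₀ f (γ (k x))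
      rw [Complex.ofReal_re, Set.projIcc_val]
    have h2 := NonUnitalStarAlgHom.map_cfcₙ Θ
      (fun z : ℂ => ext0 x₀ f (γ (Set.projIcc 0 1 zero_le_one z.re))) κ hFc.continuousOn hF0
      (starHom_continuous Θ) (by constructor; exact mul_comm _ _) (by
        constructor
        change star (Θ κ) * Θ κ = Θ κ * star (Θ κ)
        rw [← map_star, ← map_mul, ← map_mul, mul_comm])
    rw [← h2, h1]
    change J _ * P = ρ f
    rw [hJ, hρP]

end GetX

lemma get_V {n : ℕ} {A : Type*} [NonUnitalCommCStarAlgebra A] (u : ℕ → A) (hu1 : ∀ m, ‖u m‖ ≤ 1)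
    (hus : ∀ m, star (u m) = u m)
    (hu2 : ∀ l m, l ≤ m → ∃ s, u m - u l = (u m - u l) * (u m - u l) + star s * s)
    (hu4 : ∀ f, Tendsto (fun m => u m * f) atTop (𝓝 f))
    {H : Type*} [NormedAddCommGroup H] [InnerProductSpace ℂ H] [CompleteSpace H]
    (φ : Matrix (Fin n) (Fin n) A →⋆ₙₐ[ℂ] (H →L[ℂ] H)) (o : Fin n) :
    ∃ V : Fin n → (H →L[ℂ] H),
      (∀ i z, (∀ f, z * φ f = φ f * z) → z * V i = V i * z) ∧
      (∀ i j, star (V i) * V j = if i = j then V o else 0) ∧ (∀ i, V i * V o = V i) ∧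
      V o * V o = V o ∧ star (V o) = V o ∧
      (∀ f, V o * φ (Matrix.single o o f) = φ (Matrix.single o o f)) ∧
      ∀ i j f, V i * φ (Matrix.single o o f) * star (V j) = φ (Matrix.single i j f) := by
  obtain ⟨D, hD⟩ : ∃ D : Fin n → Fin n → A → (H →L[ℂ] H),
    ∀ i j f, D i j f = φ (Matrix.single i j f) := ⟨_, fun _ _ _ => rfl⟩
  have hDm : ∀ i j k f g, D i j f * D j k g = D i k (f * g) := by
    intro i j k f g
    rw [hD, hD, hD, ← map_mul, Matrix.single_mul_single_same]
  have hDn : ∀ i j j' k f g, j ≠ j' → D i j f * D j' k g = 0 := by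
    intro i j j' k f g hj
    rw [hD, hD, ← map_mul, Matrix.single_mul_single_of_ne _ _ _ _ hj, map_zero]
  have hDs : ∀ i j f, star (D i j f) = D j i (star f) := by
    intro i j f
    rw [hD, hD, ← map_star, Matrix.star_eq_conjTranspose, Matrix.conjTranspose_single]
  have hDa : ∀ i j f g, D i j (f + g) = D i j f + D i j g := by
    intro i j f g
    rw [hD, hD, hD, ← map_add, Matrix.single_add]
  have hDc : ∀ i j (c : ℂ) f, D i j (c • f) = c • D i j f := by
    intro i j c f
    rw [hD, hD, ← map_smul, Matrix.smul_single]
  have hD0 : ∀ i j, D i j 0 = 0 := by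
    intro i j
    rw [hD, Matrix.single_zero, map_zero]
  have hDsub : ∀ i j f g, D i j (f - g) = D i j f - D i j g := by
    intro i j f g
    rw [eq_sub_iff_add_eq, ← hDa, sub_add_cancel]
  have hDd : ∀ l f, ‖D l l f‖ ≤ ‖f‖ := by
    intro l f
    let δ : A →⋆ₙₐ[ℂ] (H →L[ℂ] H) :=
      { toFun := D l l
        map_smul' := hDc l l
        map_zero' := hD0 l l
        map_add' := hDa l l
        map_mul' := fun a b => (hDm l l l a b).symm
        map_star' := fun a => (hDs l l a).symm }
    exact NonUnitalStarAlgHom.norm_apply_le δ f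
  have hDb : ∀ i l f, ‖D i l f‖ ≤ ‖f‖ := by
    intro i l f
    have h1 : ‖D i l f‖ * ‖D i l f‖ ≤ ‖f‖ * ‖f‖ := by
      rw [← CStarRing.norm_star_mul_self, ← CStarRing.norm_star_mul_self, hDs, hDm]
      exact hDd _ _
    exact abs_le_of_sq_le_sq' (by nlinarith) (norm_nonneg _) |>.2
  -- norm limits
  have hlim : ∀ i l f, Tendsto (fun m => D i l (u m * f)) atTop (𝓝 (D i l f)) := by
    intro i l f
    rw [tendsto_iff_norm_sub_tendsto_zero]
    refine squeeze_zero (fun _ => norm_nonneg _) (fun m => ?_)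
      (tendsto_iff_norm_sub_tendsto_zero.1 (hu4 f))
    rw [← hDsub]
    exact hDb _ _ _
  have hlim' : ∀ i l f ξ, Tendsto (fun m => D i l (u m * f) ξ) atTop (𝓝 (D i l f ξ)) := by
    intro i l f ξ
    exact ((ContinuousLinearMap.apply ℂ H ξ).continuous.tendsto _).comp (hlim i l f)
  have key : ∀ i ξ, ∃ η, Tendsto (fun m => D i o (u m) ξ) atTop (𝓝 η) := by
    intro i ξ
    let a : ℕ → ℝ := fun m => (inner ℂ (D o o (u m) ξ) ξ).re
    have hle : ∀ l m, l ≤ m → ‖D i o (u m) ξ - D i o (u l) ξ‖ ^ 2 ≤ a m - a l := by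
      intro l m hlm
      obtain ⟨s, hs⟩ := hu2 l m hlm
      have sq : ∀ T : H →L[ℂ] H, (inner ℂ ((star T * T) ξ) ξ).re = ‖T ξ‖ ^ 2 := by
        intro T
        change (inner ℂ ((ContinuousLinearMap.adjoint T) (T ξ)) ξ).re = _
        rw [ContinuousLinearMap.adjoint_inner_left]
        rw [← RCLike.re_eq_complex_re, inner_self_eq_norm_sq]
      have e1 : a m - a l = (inner ℂ (D o o (u m - u l) ξ) ξ).re := by
        rw [hDsub, sub_apply, inner_sub_left, Complex.sub_re]
      have e2 : D o o (u m - u l) = star (D i o (u m - u l)) * D i o (u m - u l) +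
          star (D o o s) * D o o s := by
        rw [hDs, hDm, hDs, hDm, ← hDa, star_sub, hus, hus, ← hs]
      rw [e1, e2, add_apply, inner_add_left, Complex.add_re, sq, sq, hDsub, sub_apply]
      nlinarith [sq_nonneg ‖D o o s ξ‖]
    have hmono : Monotone a := by
      intro l m hlm
      have := hle l m hlm
      nlinarith [sq_nonneg ‖D i o (u m) ξ - D i o (u l) ξ‖]
    have hbdd : BddAbove (Set.range a) := by
      refine ⟨‖ξ‖ * ‖ξ‖, ?_⟩
      rintro _ ⟨m, rfl⟩
      calc a m ≤ ‖inner ℂ (D o o (u m) ξ) ξ‖ := Complex.re_le_norm _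
        _ ≤ ‖D o o (u m) ξ‖ * ‖ξ‖ := norm_inner_le_norm _ _
        _ ≤ (1 * ‖ξ‖) * ‖ξ‖ := by
          gcongr
          exact (D o o (u m)).le_of_opNorm_le ((hDb _ _ _).trans (hu1 m)) ξ
        _ = ‖ξ‖ * ‖ξ‖ := by ring
    have hca : CauchySeq a := (tendsto_atTop_ciSup hmono hbdd).cauchySeq
    refine cauchySeq_tendsto_of_complete ?_
    rw [Metric.cauchySeq_iff'] at hca ⊢
    intro ε hε
    obtain ⟨N, hN⟩ := hca (ε ^ 2) (by positivity)
    refine ⟨N, fun m hm => ?_⟩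
    have h1 := hle N m hm
    have h2 := hN m hm
    rw [Real.dist_eq] at h2
    have h3 := (le_abs_self _).trans_lt h2
    rw [dist_eq_norm]
    exact lt_of_pow_lt_pow_left₀ 2 hε.le (h1.trans_lt h3)
  choose v hv using key
  let V : Fin n → (H →L[ℂ] H) := fun i =>
    continuousLinearMapOfTendsto (fun m => D i o (u m)) (tendsto_pi_nhds.2 (hv i))
  have hV : ∀ i ξ, Tendsto (fun m => D i o (u m) ξ) atTop (𝓝 (V i ξ)) := hv
  have hVD : ∀ i l f, V i * D o l f = D i l f := by
    intro i l f
    ext ξ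
    refine tendsto_nhds_unique (hV i (D o l f ξ)) ?_
    have := hlim' i l f ξ
    refine this.congr fun m => ?_
    rw [← hDm i o l]; rfl
  have hDV : ∀ j i g, D o j g * V i = if j = i then D o o g else 0 := by
    intro j i g
    ext ξ
    have h1 : Tendsto (fun m => D o j g (D i o (u m) ξ)) atTop (𝓝 (D o j g (V i ξ))) :=
      ((D o j g).continuous.tendsto _).comp (hV i ξ)
    refine tendsto_nhds_unique h1 ?_
    by_cases hij : j = i
    · subst hij
      rw [if_pos rfl]
      refine (hlim' o o g ξ).congr fun m => ?_
      rw [mul_comm, ← hDm o j o]; rfl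
    · rw [if_neg hij]
      refine tendsto_const_nhds.congr fun m => ?_
      change _ = (D o j g * D i o (u m)) ξ
      rw [hDn _ _ _ _ _ _ hij]
  have hVsD : ∀ i j f, star (V i) * D j o f = if j = i then D o o f else 0 := by
    intro i j f
    have := congrArg star (hDV j i (star f))
    rw [star_mul, hDs, star_star] at this
    rw [this]
    split_ifs
    · rw [hDs, star_star]
    · simp
  have hVV : ∀ i j, star (V i) * V j = if i = j then V o else 0 := by
    intro i j
    ext ξ
    have h1 : Tendsto (fun m => star (V i) (D j o (u m) ξ)) atTop (𝓝 (star (V i) (V j ξ))) :=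
      ((star (V i)).continuous.tendsto _).comp (hV j ξ)
    refine tendsto_nhds_unique h1 ?_
    have h2 : ∀ m, star (V i) (D j o (u m) ξ) = (if j = i then D o o (u m) else 0) ξ := by
      intro m
      rw [← hVsD]; rfl
    simp only [h2]
    by_cases hij : i = j
    · subst hij
      simpa using hV o ξ
    · simp [hij, Ne.symm hij]
  have hVo : ∀ i, V i * V o = V i := by
    intro i
    ext ξ
    have h1 : Tendsto (fun m => V i (D o o (u m) ξ)) atTop (𝓝 (V i (V o ξ))) :=
      ((V i).continuous.tendsto _).comp (hV o ξ)
    refine tendsto_nhds_unique h1 ?_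
    refine (hV i ξ).congr fun m => ?_
    rw [← hVD i o]; rfl
  have hs : star (V o) = V o := by
    have h := hVV o o
    rw [if_pos rfl] at h
    rw [← h, star_mul, star_star]
  refine ⟨V, ?_, hVV, hVo, hVo o, hs, ?_, ?_⟩
  · intro i z hz
    ext ξ
    have h1 : Tendsto (fun m => z (D i o (u m) ξ)) atTop (𝓝 (z (V i ξ))) :=
      (z.continuous.tendsto _).comp (hV i ξ)
    refine tendsto_nhds_unique h1 ?_
    refine (hV i (z ξ)).congr fun m => ?_
    have := hz (Matrix.single i o (u m))
    rw [← hD] at this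
    exact (congrArg (fun T : H →L[ℂ] H => T ξ) this).symm
  · intro f
    rw [← hD]; exact hVD o o f
  · intro i j f
    rw [← hD, ← hD, hVD]
    have := congrArg star (hVD j i (star f))
    rw [star_mul, hDs, star_star, hDs, star_star] at this
    exact this

lemma exists_path {K : Type*} [MetricSpace K]
    (hK : ∃ g : Set.Icc (0 : ℝ) 1 → K, Continuous g ∧ Function.Surjective g) (x₀ : K) :
    ∃ g : Set.Icc (0 : ℝ) 1 → K, Continuous g ∧ Function.Surjective g ∧ g 0 = x₀ := by
  obtain ⟨g, hg, hgs⟩ := hK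
  obtain ⟨t, ht⟩ := hgs x₀
  have ht0 : 0 ≤ (t : ℝ) := t.2.1
  have ht1 : (t : ℝ) ≤ 1 := t.2.2
  let r : Set.Icc (0 : ℝ) 1 → Set.Icc (0 : ℝ) 1 := fun s =>
    ⟨|(t : ℝ) - s * (1 + t)|, abs_nonneg _, by
      have h0 : 0 ≤ (s : ℝ) := s.2.1
      have h1 : (s : ℝ) ≤ 1 := s.2.2
      rw [abs_le]
      constructor <;> nlinarith⟩
  have hr : Continuous r := by
    refine Continuous.subtype_mk ?_ _
    fun_prop
  refine ⟨g ∘ r, hg.comp hr, ?_, ?_⟩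
  · intro k
    obtain ⟨w, rfl⟩ := hgs k
    have h0 : 0 ≤ (w : ℝ) := w.2.1
    have h1 : (w : ℝ) ≤ 1 := w.2.2
    have hpos : 0 < 1 + (t : ℝ) := by linarith
    refine ⟨⟨(t + w) / (1 + t), by positivity, by rw [div_le_one hpos]; linarith⟩, ?_⟩
    have : r ⟨(t + w) / (1 + t), by positivity, by rw [div_le_one hpos]; linarith⟩ = w := by
      apply Subtype.ext
      change |(t : ℝ) - (t + w) / (1 + t) * (1 + t)| = w
      rw [div_mul_cancel₀ _ hpos.ne']
      rw [show (t : ℝ) - (t + w) = -w by ring, abs_neg, abs_of_nonneg h0]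
    change g (r _) = g w
    rw [this]
  · have : r 0 = t := by
      apply Subtype.ext
      change |(t : ℝ) - (0 : ℝ) * (1 + t)| = t
      rw [zero_mul, sub_zero, abs_of_nonneg ht0]
    change g (r 0) = x₀
    rw [this, ht]

lemma core_lift {K : Type*} [MetricSpace K] [CompactSpace K]
    (hK : ∃ g : Set.Icc (0 : ℝ) 1 → K, Continuous g ∧ Function.Surjective g)
    (x₀ : K) (n : ℕ) (o : Fin n)
    {B : Type*} [NonUnitalCStarAlgebra B]
    {H : Type*} [NormedAddCommGroup H] [InnerProductSpace ℂ H] [CompleteSpace H]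
    (W : VonNeumannAlgebra H)
    (q : B →⋆ₙₐ[ℂ] (H →L[ℂ] H)) (hq : ∀ T ∈ W, ∃ b, q b = T)
    (φ : Matrix (Fin n) (Fin n) (ZeroAtInftyContinuousMap {x : K // x ≠ x₀} ℂ)
        →⋆ₙₐ[ℂ] (H →L[ℂ] H)) (hφ : ∀ f, φ f ∈ W) :
    ∃ ψ : Matrix (Fin n) (Fin n) (ZeroAtInftyContinuousMap {x : K // x ≠ x₀} ℂ)
        →⋆ₙₐ[ℂ] B, ∀ x, q (ψ x) = φ x := by
  letI : PartialOrder B := CStarAlgebra.spectralOrder B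
  haveI : StarOrderedRing B := CStarAlgebra.spectralOrderedRing B
  obtain ⟨γ, hγ, hγs, hγ0⟩ := exists_path hK x₀
  obtain ⟨u, hu1, hus, hu2, -, hu4⟩ := exists_approx_unit x₀
  obtain ⟨V, hVW, hVV, hVo, hPP, hPs, hPD, hVDV⟩ := get_V u hu1 hus hu2 hu4 φ o
  have hWmem : ∀ T : H →L[ℂ] H, (∀ z ∈ W.commutant, z * T = T * z) → T ∈ W := by
    intro T hT
    rw [← VonNeumannAlgebra.commutant_commutant W, VonNeumannAlgebra.mem_commutant_iff]
    exact hT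
  have hcomm : ∀ z ∈ W.commutant, ∀ f, z * φ f = φ f * z := fun z hz f =>
    (VonNeumannAlgebra.mem_commutant_iff.1 hz _ (hφ f)).symm
  have hVmem : ∀ i, V i ∈ W := fun i => hWmem _ fun z hz => hVW i z (hcomm z hz)
  let ρ : ZeroAtInftyContinuousMap {x : K // x ≠ x₀} ℂ →⋆ₙₐ[ℂ] (H →L[ℂ] H) :=
    { toFun := fun f => φ (Matrix.single o o f)
      map_smul' := fun c f => by rw [← Matrix.smul_single, map_smul]; rfl
      map_zero' := by rw [Matrix.single_zero, map_zero]
      map_add' := fun a b => by rw [Matrix.single_add, map_add]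
      map_mul' := fun a b => by rw [← map_mul, Matrix.single_mul_single_same]
      map_star' := fun a => by
        rw [← map_star, Matrix.star_eq_conjTranspose, Matrix.conjTranspose_single] }
  have hρ : ∀ f, ρ f = φ (Matrix.single o o f) := fun _ => rfl
  obtain ⟨x, hx0, hPx, hxc, hxf⟩ := get_x x₀ ρ γ hγ hγs hγ0 (V o) hPP hPs hPD
  have hxW : x ∈ W := hWmem _ fun z hz => hxc z (fun f => hcomm z hz _) (hVW o z (hcomm z hz))
  obtain ⟨y, h, hh0, hqh, hqy, hyy⟩ := cone_lift q (V o) x V hVV hVo hPP hPs hPx hx0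
    (fun i => hq _ (hVmem i)) (hq _ (hVmem o)) (hq _ hxW)
  have hsa : star h = h := (IsSelfAdjoint.of_nonneg hh0).star_eq
  have hn : IsStarNormal h := (IsSelfAdjoint.of_nonneg hh0).isStarNormal
  obtain ⟨g, -, hg2, hg3, hg4⟩ := exists_gm h hn
  let γc : ℂ → K := fun z => γ (Set.projIcc 0 1 zero_le_one z.re)
  have hγc : Continuous γc := hγ.comp (continuous_projIcc.comp Complex.continuous_re)
  have hγc0 : γc 0 = x₀ := by
    have : Set.projIcc (0 : ℝ) 1 zero_le_one (0 : ℂ).re = 0 := by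
      rw [Complex.zero_re]; exact Set.projIcc_left zero_le_one
    change γ (Set.projIcc 0 1 zero_le_one (0 : ℂ).re) = x₀
    rw [this, hγ0]
  have hFc : ∀ f, Continuous (fun z => ext0 x₀ f (γc z)) := fun f =>
    (ext0_continuous x₀ f).comp hγc
  have hF0 : ∀ f, ext0 x₀ f (γc 0) = 0 := fun f => by rw [hγc0, ext0_self]
  let α := alphaHom x₀ γc hγc hγc0 h hn
  have hα1 : ∀ f, Tendsto (fun m => h * g m * α f) atTop (𝓝 (α f)) := fun f =>
    (hg4 _ (hFc f) (hF0 f)).1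
  have hα2 : ∀ f, Tendsto (fun m => α f * (h * g m)) atTop (𝓝 (α f)) := fun f =>
    (hg4 _ (hFc f) (hF0 f)).2
  obtain ⟨ψ, hψ⟩ := exists_psi α y h g hsa hyy hg2 hg3 hα1 hα2
  have hqc : Continuous q := starHom_continuous q
  have hqα : ∀ f, q (α f) = ρ f := by
    intro f
    have h2 := NonUnitalStarAlgHom.map_cfcₙ q (fun z => ext0 x₀ f (γc z)) h (hFc f).continuousOn
      (hF0 f) hqc hn (by rw [hqh]; exact (IsSelfAdjoint.of_nonneg hx0).isStarNormal)
    change q (cfcₙ (fun z => ext0 x₀ f (γc z)) h) = ρ f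
    rw [h2, hqh]
    exact hxf f
  have hgs : ∀ m, star (g m) * h = h * g m := by
    intro m
    have := hg2 m
    rwa [star_mul, hsa] at this
  have heae : ∀ f, Tendsto (fun m => (h * g m) * α f * (h * g m)) atTop (𝓝 (α f)) := by
    intro f
    have h1 : Tendsto (fun m => (h * g m * α f - α f) * (h * g m) + α f * (h * g m)) atTop
        (𝓝 (0 + α f)) := by
      refine Tendsto.add ?_ (hα2 f)
      refine squeeze_zero_norm (a := fun m => ‖h * g m * α f - α f‖) (fun m => ?_) ?_
      · calc ‖(h * g m * α f - α f) * (h * g m)‖ ≤ ‖h * g m * α f - α f‖ * ‖h * g m‖ :=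
              norm_mul_le _ _
          _ ≤ ‖h * g m * α f - α f‖ * 1 := by gcongr; exact hg3 m
          _ = _ := mul_one _
      · exact (tendsto_iff_norm_sub_tendsto_zero.1 (hα1 f))
    rw [zero_add] at h1
    refine h1.congr fun m => ?_
    rw [sub_mul, sub_add_cancel]
  have hxs : star x = x := (IsSelfAdjoint.of_nonneg hx0).star_eq
  refine ⟨ψ, fun f => ?_⟩
  have l1 : Tendsto (fun m => q (∑ i, ∑ j, y i * (g m * α (f i j) * star (g m)) * star (y j))) atTop
      (𝓝 (q (ψ f))) := (hqc.tendsto _).comp (hψ f)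
  refine tendsto_nhds_unique l1 ?_
  have l2 : ∀ m, q (∑ i, ∑ j, y i * (g m * α (f i j) * star (g m)) * star (y j)) =
      ∑ i, ∑ j, V i * q ((h * g m) * α (f i j) * (h * g m)) * star (V j) := by
    intro m
    rw [map_sum]
    refine Finset.sum_congr rfl fun i _ => ?_
    rw [map_sum]
    refine Finset.sum_congr rfl fun j _ => ?_
    have e1 : (h * g m) * α (f i j) * (h * g m) = h * (g m * α (f i j) * star (g m)) * h := by
      conv_lhs => rw [← hgs m]
      rw [hgs m]
      nth_rewrite 2 [← hgs m]
      simp only [mul_assoc]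
    rw [e1]
    simp only [map_mul, map_star, hqy, hqh, star_mul, hxs, mul_assoc]
  simp only [l2]
  have e3 : φ f = ∑ i, ∑ j, V i * q (α (f i j)) * star (V j) := by
    conv_lhs => rw [Matrix.matrix_eq_sum_single f]
    rw [map_sum]
    refine Finset.sum_congr rfl fun i _ => ?_
    rw [map_sum]
    refine Finset.sum_congr rfl fun j _ => ?_
    rw [hqα, hρ, hVDV]
  rw [e3]
  refine tendsto_finsetSum _ fun i _ => tendsto_finsetSum _ fun j _ => ?_
  exact ((((hqc.tendsto _).comp (heae (f i j))).const_mul (V i)).mul_const (star (V j)))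

end Helpers

/-- Theorem 3.4: if `K` is a continuous image of `[0,1]` and `x₀ ∈ K`, then
`C₀(K∖{x₀}) ⊗ Mₙ` (realized as `n × n` matrices over the continuous functions on `K`
vanishing at `x₀`, i.e. over `C₀(K∖{x₀})`) is C*-W*-projective in the non-unital category:
every *-homomorphism from it into a von Neumann algebra lifts through any surjective
*-homomorphism from a C*-algebra onto that von Neumann algebra. -/
theorem cone_matrices_CstarWstar_projective
    {K : Type*} [MetricSpace K] [CompactSpace K]
    (hK : ∃ g : Set.Icc (0 : ℝ) 1 → K, Continuous g ∧ Function.Surjective g)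
    (x₀ : K) (n : ℕ)
    {B : Type*} [NonUnitalNormedRing B] [StarRing B] [CStarRing B] [CompleteSpace B]
    [NormedSpace ℂ B] [IsScalarTower ℂ B B] [SMulCommClass ℂ B B] [StarModule ℂ B]
    {H : Type*} [NormedAddCommGroup H] [InnerProductSpace ℂ H] [CompleteSpace H]
    (W : VonNeumannAlgebra H)
    (q : B →⋆ₙₐ[ℂ] W.toStarSubalgebra) (hq : Function.Surjective q)
    (φ : Matrix (Fin n) (Fin n) (ZeroAtInftyContinuousMap {x : K // x ≠ x₀} ℂ)
        →⋆ₙₐ[ℂ] W.toStarSubalgebra) :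
    ∃ ψ : Matrix (Fin n) (Fin n) (ZeroAtInftyContinuousMap {x : K // x ≠ x₀} ℂ)
        →⋆ₙₐ[ℂ] B, ∀ x, q (ψ x) = φ x := by
  rcases Nat.eq_zero_or_pos n with hn | hn
  · subst hn
    exact ⟨0, fun x => by
      have : x = 0 := Subsingleton.elim _ _
      rw [this, map_zero, map_zero, map_zero]⟩
  · letI : NonUnitalCStarAlgebra B := {}
    let S := NonUnitalStarAlgHomClass.toNonUnitalStarAlgHom W.toStarSubalgebra.subtype
    obtain ⟨ψ, hψ⟩ := core_lift hK x₀ n ⟨0, hn⟩ W (S.comp q)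
      (fun T hT => by
        obtain ⟨b, hb⟩ := hq ⟨T, hT⟩
        exact ⟨b, congrArg Subtype.val hb⟩)
      (S.comp φ) (fun f => (φ f).2)
    exact ⟨ψ, fun x => Subtype.ext (hψ x)⟩
end

section
/- Let π : B → M be a surjective *-homomorphism from a von Neumann algebra B onto a C*-algebra M, and let ρ : Mₙ(ℂ) → M be a (not necessarily unital) *-homomorphism. Then there exists a *-homomorphism γ : Mₙ(ℂ) → B with π ∘ γ = ρ. -/
lemma starAlgHom_cont {A M : Type*} [CStarAlgebra A] [CStarAlgebra M] (π : A →⋆ₐ[ℂ] M) :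
    Continuous π :=
  AddMonoidHomClass.continuous_of_bound π 1 fun x => by
    simpa using NonUnitalStarAlgHom.norm_apply_le π x

lemma vn_range_proj {H : Type*} [NormedAddCommGroup H] [InnerProductSpace ℂ H] [CompleteSpace H]
    (B : VonNeumannAlgebra H) (y : B.toStarSubalgebra) :
    ∃ q : B.toStarSubalgebra, IsStarProjection q ∧ q * y = y ∧
      ∀ z : B.toStarSubalgebra, z * y = 0 → z * q = 0 := by
  obtain ⟨y, hy⟩ := y
  let U : Submodule ℂ H := y.range.topologicalClosure
  have hUc : CompleteSpace U := (Submodule.isClosed_topologicalClosure _).completeSpace_coe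
  have hP : IsStarProjection U.starProjection := isStarProjection_starProjection
  have key : ∀ z : H →L[ℂ] H, z * y = 0 → ∀ u ∈ U, z u = 0 := by
    intro z hz u hu
    have : U ≤ z.ker := by
      apply Submodule.topologicalClosure_minimal _ _ z.isClosed_ker
      rintro _ ⟨x, rfl⟩
      exact congr($hz x)
    exact this hu
  have hmem : U.starProjection ∈ B := by
    rw [VonNeumannAlgebra.IsStarProjection.mem_iff hP]
    intro w hw
    rw [Submodule.range_starProjection]
    rw [VonNeumannAlgebra.mem_commutant_iff] at hw
    have hc := hw y hy
    have : U ≤ U.comap (w : H →ₗ[ℂ] H) := by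
      apply Submodule.topologicalClosure_minimal
      · rintro _ ⟨x, rfl⟩
        apply Submodule.le_topologicalClosure
        exact ⟨w x, congr($hc x)⟩
      · exact (Submodule.isClosed_topologicalClosure _).preimage w.continuous
    exact this
  refine ⟨⟨U.starProjection, hmem⟩, ⟨?_, ?_⟩, ?_, ?_⟩
  · exact Subtype.ext hP.isIdempotentElem
  · exact Subtype.ext hP.isSelfAdjoint
  · apply Subtype.ext
    ext x
    exact Submodule.starProjection_eq_self_iff.2 (Submodule.le_topologicalClosure _ ⟨x, rfl⟩)
  · rintro ⟨z, hz⟩ h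
    apply Subtype.ext
    ext x
    exact key z congr(Subtype.val $h) _ (Submodule.starProjection_apply_mem _ _)

/-- Cut-down lemma. -/
lemma cut_lemma {A M : Type*} [CStarAlgebra A] [CStarAlgebra M] (π : A →⋆ₐ[ℂ] M)
    (hR : ∀ y : A, ∃ q : A, IsStarProjection q ∧ q * y = y ∧ ∀ z : A, z * y = 0 → z * q = 0)
    (r k : A) (hk : IsSelfAdjoint k) (hrk : r * k = k) (p : M) (hp : IsStarProjection p)
    (hkp : π k = p) :
    ∃ q : A, IsStarProjection q ∧ r * q = q ∧ π q = p ∧ ‖q - q * k * q‖ ≤ 1 / 2 := by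
  let g : ℝ → ℝ := fun t => max 0 (1 - 4 * |1 - t|)
  let l : ℝ → ℝ := fun t => 1 / max t (1/2)
  let ψ : ℝ → ℝ := fun t => max (-(1/2)) (min (1 - t) (1/2))
  have hg : Continuous g := by fun_prop
  have hl : Continuous l := by
    apply Continuous.div (by fun_prop) (by fun_prop)
    intro t; positivity
  have hψ : Continuous ψ := by fun_prop
  have gsupp : ∀ t, g t = 0 ∨ (3/4 ≤ t ∧ t ≤ 5/4) := by
    intro t
    by_cases h : 1 - 4 * |1 - t| ≤ 0
    · left; exact max_eq_left h
    · right
      push Not at h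
      have := abs_le.1 (show |1 - t| ≤ 1/4 by linarith)
      constructor <;> linarith [this.1, this.2]
  have h1 : k * cfc l k * cfc g k = cfc g k := by
    conv_lhs => rw [← cfc_id' ℝ k]
    rw [cfc_id' ℝ k]
    nth_rw 1 [← cfc_id' ℝ k]
    rw [← cfc_mul (fun x => x) l k (by fun_prop) hl.continuousOn,
      ← cfc_mul _ g k (by fun_prop) hg.continuousOn]
    congr 1
    ext t
    rcases gsupp t with h | h
    · simp [h]
    · have : max t (1/2) = t := max_eq_left (by linarith)
      simp only [l, this]
      have : t ≠ 0 := by linarith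
      field_simp
  have h2 : (1 - k) * cfc g k = cfc ψ k * cfc g k := by
    have : 1 - k = cfc (fun t : ℝ => 1 - t) k := by
      rw [cfc_sub (fun _ => (1:ℝ)) (fun x => x) k, cfc_id' ℝ k, cfc_const_one ℝ k]
    rw [this, ← cfc_mul _ g k (by fun_prop) hg.continuousOn,
      ← cfc_mul _ g k hψ.continuousOn hg.continuousOn]
    congr 1
    ext t
    rcases gsupp t with h | h
    · simp [h]
    · have : ψ t = 1 - t := by
        simp only [ψ]
        rw [min_eq_left (by linarith), max_eq_right (by linarith)]
      rw [this]
  have hψn : ‖cfc ψ k‖ ≤ 1/2 := by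
    apply norm_cfc_le (by norm_num)
    intro t _
    rw [Real.norm_eq_abs, abs_le]
    exact ⟨le_max_left _ _, max_le (by norm_num) (min_le_right _ _)⟩
  have hps : IsSelfAdjoint p := hp.isSelfAdjoint
  have hcp : ∀ f : ℝ → ℝ, Continuous f → f 0 = 0 → f 1 = 1 → cfc f p = p := by
    intro f hf f0 f1
    conv_rhs => rw [← cfc_id' ℝ p]
    apply cfc_congr
    intro t ht
    rcases hp.isIdempotentElem.spectrum_subset ℝ ht with h | h
    · simp [h, f0]
    · have : t = 1 := h
      simp [this, f1]
  have hπc : Continuous π := starAlgHom_cont π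
  have hπg : π (cfc g k) = p := by
    rw [StarAlgHom.map_cfc π g k hg.continuousOn hπc hk (hk.map π), hkp]
    apply hcp g hg <;> simp [g]
  have hπl : π (k * cfc l k) = p := by
    nth_rw 1 [← cfc_id' ℝ k]
    rw [← cfc_mul (fun x => x) l k (by fun_prop) hl.continuousOn]
    rw [StarAlgHom.map_cfc π _ k (by fun_prop) hπc hk (hk.map π), hkp]
    apply hcp _ (by fun_prop) <;> simp [l]
    norm_num
  obtain ⟨q, hq, hqg, hz⟩ := hR (cfc g k)
  have e1 : r * q = q := by
    have := hz (r - 1) (by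
      rw [← h1, sub_mul, ← mul_assoc, ← mul_assoc, hrk]; simp)
    simpa [sub_mul, sub_eq_zero] using this
  have e2 : k * cfc l k * q = q := by
    have := hz (k * cfc l k - 1) (by rw [sub_mul, h1]; simp)
    simpa [sub_mul, sub_eq_zero] using this
  have e3 : (1 - k) * q = cfc ψ k * q := by
    have := hz ((1 - k) - cfc ψ k) (by rw [sub_mul, h2]; simp)
    simpa [sub_mul, sub_eq_zero] using this
  refine ⟨q, hq, e1, ?_, ?_⟩
  · have a1 : p * π q = π q := by rw [← hπl, ← map_mul, e2]
    have a2 : π q * p = p := by rw [← hπg, ← map_mul, hqg]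
    have a3 := congr(star $a2)
    rw [star_mul, ← map_star, hq.isSelfAdjoint.star_eq, hps.star_eq] at a3
    rw [← a1, a3]
  · have : q - q * k * q = q * (cfc ψ k * q) := by
      rw [← e3, sub_mul, one_mul, mul_sub, hq.isIdempotentElem.eq, mul_assoc]
    rw [this]
    have hn : ‖q‖ ≤ 1 := hq.norm_le
    calc _ ≤ ‖q‖ * (‖cfc ψ k‖ * ‖q‖) := (norm_mul_le _ _).trans (by gcongr; exact norm_mul_le _ _)
      _ ≤ 1 * (1/2 * 1) := by gcongr
      _ = _ := by norm_num

lemma inv_sqrt_lemma {A M : Type*} [CStarAlgebra A] [CStarAlgebra M] (π : A →⋆ₐ[ℂ] M)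
    (m : A) (hm : IsSelfAdjoint m) (hn : ‖1 - m‖ ≤ 1 / 2) (hπ : π m = 1) :
    ∃ s : A, IsSelfAdjoint s ∧ s * m * s = 1 ∧ π s = 1 ∧ ∀ q, Commute m q → Commute s q := by
  let f : ℝ → ℝ := fun t => 1 / Real.sqrt (max t (1/2))
  have hf : Continuous f := by
    apply Continuous.div (by fun_prop) (by fun_prop)
    intro t; positivity
  refine ⟨cfc f m, cfc_predicate f m, ?_, ?_, fun q hq => hq.cfc_real f⟩
  · nth_rw 2 [← cfc_id' ℝ m]
    rw [← cfc_mul f (fun x => x) m hf.continuousOn (by fun_prop),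
      ← cfc_mul _ f m (by fun_prop) hf.continuousOn, ← cfc_const_one ℝ m]
    apply cfc_congr
    intro t ht
    have h1 : 1 - m = cfc (fun t : ℝ => 1 - t) m := by
      rw [cfc_sub (fun _ => (1:ℝ)) (fun x => x) m, cfc_id' ℝ m, cfc_const_one ℝ m]
    have h2 := norm_apply_le_norm_cfc (fun t : ℝ => 1 - t) m ht
    rw [← h1] at h2
    have h3 := abs_le.1 (h2.trans hn)
    have h4 : max t (1/2) = t := max_eq_left (by linarith [h3.2])
    have h5 : 0 < t := by linarith [h3.2]
    simp only [f, h4]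
    have := Real.mul_self_sqrt h5.le
    have : 0 < Real.sqrt t := Real.sqrt_pos.2 h5
    field_simp
    linarith
  · rw [StarAlgHom.map_cfc π f m hf.continuousOn (starAlgHom_cont π) hm (hm.map π), hπ,
      cfc_apply_one]
    simp [f]
    norm_num

lemma step_family {A M : Type*} [CStarAlgebra A] [CStarAlgebra M] (π : A →⋆ₐ[ℂ] M)
    (hπ : Function.Surjective π)
    (hR : ∀ y : A, ∃ q : A, IsStarProjection q ∧ q * y = y ∧ ∀ z : A, z * y = 0 → z * q = 0)
    (p : M) (hp : IsStarProjection p) (e : ℕ → M) (N : ℕ)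
    (he : ∀ i < N, ∀ j < N, e i * star (e j) = if i = j then p else 0)
    (hpe : ∀ i < N, p * e i = e i) (k : ℕ) (hkN : k ≤ N) :
    ∃ (r : A) (v : ℕ → A), IsStarProjection r ∧ π r * p = p ∧ (∀ i < k, π (v i) = e i) ∧
      (∀ i < k, r * v i = v i) ∧
      ∀ i < k, ∀ j < k, v i * star (v j) = if i = j then r else 0 := by
  induction k with
  | zero => exact ⟨1, 0, by simp, by simp, by simp, by simp, by simp⟩
  | succ k ih =>
    obtain ⟨r, v, hr, hrp, hv, hrv, hvv⟩ := ih (by omega)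
    have hk : k < N := by omega
    obtain ⟨x₀, hx₀⟩ := hπ (e k)
    have hvr : ∀ i < k, star (v i) * r = star (v i) := by
      intro i hi
      have := congr(star $(hrv i hi))
      rwa [star_mul, hr.isSelfAdjoint.star_eq] at this
    let x := x₀ - x₀ * ∑ i ∈ Finset.range k, star (v i) * v i
    have hx : π x = e k := by
      simp only [x, map_sub, map_mul, map_sum, hx₀, map_star, Finset.mul_sum]
      rw [Finset.sum_eq_zero, sub_zero]
      intro i hi
      rw [Finset.mem_range] at hi
      rw [hv i hi, ← mul_assoc, he k hk i (by omega), if_neg hi.ne', zero_mul]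
    have hxv : ∀ i < k, x * star (v i) = 0 := by
      intro i hi
      simp only [x, sub_mul, mul_assoc, Finset.sum_mul]
      rw [Finset.sum_eq_single i]
      · rw [hvv i hi i hi, if_pos rfl, hvr i hi, sub_self]
      · intro j hj hji
        rw [Finset.mem_range] at hj
        rw [hvv j hj i hi, if_neg hji, mul_zero]
      · intro h; exact absurd (Finset.mem_range.2 hi) h
    have hpr : p * π r = p := by
      have := congr(star $hrp)
      rwa [star_mul, ← map_star, hr.isSelfAdjoint.star_eq, hp.isSelfAdjoint.star_eq] at this
    have hkp : π (r * x * star (r * x)) = p := by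
      rw [star_mul, hr.isSelfAdjoint.star_eq]
      simp only [map_mul, map_star, hx]
      rw [mul_assoc, ← mul_assoc (e k), he k hk k hk, if_pos rfl, hpr, hrp]
    obtain ⟨q, hq, hrq, hπq, hqn⟩ := cut_lemma π hR r (r * x * star (r * x))
      (IsSelfAdjoint.mul_star_self _) (by rw [← mul_assoc, ← mul_assoc, hr.isIdempotentElem.eq])
      p hp hkp
    have hqs := hq.isSelfAdjoint.star_eq
    have hqq := hq.isIdempotentElem.eq
    have hqr : q * r = q := by
      have := congr(star $hrq)
      rwa [star_mul, hqs, hr.isSelfAdjoint.star_eq] at this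
    have hK : q * (r * x * star (r * x)) * q = q * x * star (q * x) := by
      simp only [star_mul, hqs, hr.isSelfAdjoint.star_eq]
      calc _ = (q * r) * x * star x * (r * q) := by simp only [mul_assoc]
        _ = _ := by rw [hqr, hrq]; simp only [mul_assoc]
    rw [hK] at hqn
    set K := q * x * star (q * x) with hKdef
    have hKs : IsSelfAdjoint K := IsSelfAdjoint.mul_star_self _
    have hqK : q * K = K := by rw [hKdef, ← mul_assoc, ← mul_assoc, hqq]
    have hKq : K * q = K := by
      have := congr(star $hqK)
      rwa [star_mul, hqs, hKs.star_eq] at this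
    have hπK : π K = p := by
      rw [hKdef, star_mul, hqs]
      simp only [map_mul, map_star, hx, hπq]
      rw [mul_assoc, ← mul_assoc (e k), he k hk k hk, if_pos rfl, hp.isIdempotentElem.eq,
        hp.isIdempotentElem.eq]
    obtain ⟨s, hs, hsm, hπs, hsc⟩ := inv_sqrt_lemma π (K + (1 - q))
      (hKs.add ((IsSelfAdjoint.one A).sub hq.isSelfAdjoint))
      (by convert hqn using 2; abel) (by simp [hπK, hπq])
    have hsq : s * q = q * s := by
      apply hsc
      simp only [commute_iff_eq, add_mul, mul_add, sub_mul, mul_sub, hqK, hKq, hqq]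
      simp
    have hmq : (K + (1 - q)) * q = K := by simp [add_mul, sub_mul, hKq, hqq]
    have hww : s * (q * x) * star (s * (q * x)) = q := by
      rw [star_mul, hs.star_eq]
      calc _ = s * K * s := by rw [hKdef]; simp only [mul_assoc]
        _ = s * (K + (1 - q)) * (q * s) := by
          rw [mul_assoc s (K + _), ← mul_assoc (K + _) q, hmq, mul_assoc]
        _ = _ := by rw [← hsq, ← mul_assoc, hsm, one_mul]
    have hwv : ∀ i < k, s * (q * x) * star (q * v i) = 0 := by
      intro i hi
      calc _ = s * q * (x * star (v i)) * q := by rw [star_mul, hqs]; simp only [mul_assoc]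
        _ = 0 := by rw [hxv i hi]; simp
    have hvw : ∀ i < k, q * v i * star (s * (q * x)) = 0 := by
      intro i hi
      have := congr(star $(hwv i hi))
      rwa [star_mul, star_star, star_zero] at this
    refine ⟨q, fun i => if i < k then q * v i else s * (q * x), hq, ?_, ?_, ?_, ?_⟩
    · rw [hπq, hp.isIdempotentElem.eq]
    · intro i hi
      by_cases h : i < k
      · simp only [h, if_true, map_mul, hπq, hv i h, hpe i (by omega)]
      · obtain rfl : i = k := by omega
        simp only [lt_irrefl, if_false, map_mul, hπq, hπs, hx, hpe i hk, one_mul]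
    · intro i hi
      by_cases h : i < k
      · simp only [h, if_true, ← mul_assoc, hqq]
      · simp only [h, if_false]
        rw [← mul_assoc, ← hsq, mul_assoc, ← mul_assoc q, hqq]
    · intro i hi j hj
      by_cases h : i < k <;> by_cases h' : j < k
      · simp only [h, h', if_true]
        rw [star_mul, hqs]
        calc _ = q * (v i * star (v j)) * q := by simp only [mul_assoc]
          _ = _ := by
            rw [hvv i h j h']
            split_ifs
            · rw [hqr, hqq]
            · simp
      · simp only [h, h', if_true, if_false]
        rw [hvw i h, if_neg (by omega)]
      · simp only [h, h', if_true, if_false]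
        rw [hwv j h', if_neg (by omega)]
      · simp only [h, h', if_false]
        rw [hww, if_pos (by omega)]

lemma lift_abstract {A M : Type*} [CStarAlgebra A] [CStarAlgebra M] (π : A →⋆ₐ[ℂ] M)
    (hπ : Function.Surjective π)
    (hR : ∀ y : A, ∃ q : A, IsStarProjection q ∧ q * y = y ∧ ∀ z : A, z * y = 0 → z * q = 0)
    (n : ℕ) (ρ : Matrix (Fin n) (Fin n) ℂ →⋆ₙₐ[ℂ] M) :
    ∃ γ : Matrix (Fin n) (Fin n) ℂ →⋆ₙₐ[ℂ] A, ∀ x, π (γ x) = ρ x := by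
  rcases n with _ | n
  · refine ⟨0, fun x => ?_⟩
    have : x = 0 := Subsingleton.elim _ _
    subst this
    simp
  let E : Fin (n + 1) → Fin (n + 1) → Matrix (Fin (n + 1)) (Fin (n + 1)) ℂ :=
    fun i j => Matrix.single i j 1
  have hEstar : ∀ i j, star (E i j) = E j i := by
    intro i j
    simp [E, Matrix.star_eq_conjTranspose, Matrix.conjTranspose_single]
  have hEmul : ∀ i j k l, E i j * E k l = if j = k then E i l else 0 := by
    intro i j k l
    split_ifs with h
    · subst h; simp [E]
    · simp [E, h]
  have hsum : ∀ X : Matrix (Fin (n + 1)) (Fin (n + 1)) ℂ, X = ∑ i, ∑ j, X i j • E i j := by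
    intro X
    conv_lhs => rw [Matrix.matrix_eq_sum_single X]
    simp [E]
  let e : ℕ → M := fun i => if h : i < n + 1 then ρ (E 0 ⟨i, h⟩) else 0
  -- family indexed by naturals, extended by zero
  have main : ∃ (r : A) (v : Fin (n + 1) → A), IsStarProjection r ∧
      (∀ i, π (v i) = ρ (E 0 i)) ∧ (∀ i, r * v i = v i) ∧
      ∀ i j, v i * star (v j) = if i = j then r else 0 := by
    have hp : IsStarProjection (ρ (E 0 0)) := by
      constructor
      · rw [IsIdempotentElem, ← map_mul, hEmul, if_pos rfl]
      · rw [IsSelfAdjoint, ← map_star, hEstar]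
    obtain ⟨r, v, hr, -, hv, hrv, hvv⟩ := step_family π hπ hR (ρ (E 0 0)) hp e (n + 1)
      (by
        intro i hi j hj
        simp only [e, hi, hj, dif_pos]
        rw [← map_star, ← map_mul, hEstar, hEmul]
        by_cases h : i = j <;> simp [h])
      (by
        intro i hi
        simp only [e, hi, dif_pos]
        rw [← map_mul, hEmul, if_pos rfl])
      (n + 1) le_rfl
    refine ⟨r, fun i => v i, hr, fun i => ?_, fun i => hrv i i.2, fun i j => ?_⟩
    · rw [hv i i.2]
      simp only [e, i.2, dif_pos]
    · rw [hvv i i.2 j j.2]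
      simp [Fin.ext_iff]
  obtain ⟨r, v, hr, hv, hrv, hvv⟩ := main
  let γ : Matrix (Fin (n + 1)) (Fin (n + 1)) ℂ →⋆ₙₐ[ℂ] A :=
    { toFun := fun X => ∑ i, ∑ j, X i j • (star (v i) * v j)
      map_smul' := by
        intro c X
        simp [Finset.smul_sum, smul_smul]
      map_zero' := by simp
      map_add' := by
        intro X Y
        simp [add_smul, Finset.sum_add_distrib]
      map_mul' := by
        intro X Y
        have h4 : ∀ i j k l, (star (v i) * v j) * (star (v k) * v l)
            = if j = k then star (v i) * v l else 0 := by
          intro i j k l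
          calc _ = star (v i) * (v j * star (v k)) * v l := by simp only [mul_assoc]
            _ = _ := by
              rw [hvv]
              split_ifs
              · rw [mul_assoc, hrv]
              · simp
        simp only [Finset.sum_mul, Finset.mul_sum, smul_mul_smul_comm, h4, Matrix.mul_apply,
          Finset.sum_smul, smul_ite, smul_zero]
        simp only [Finset.sum_ite_eq, Finset.sum_ite_eq', Finset.mem_univ, if_true]
        rw [Finset.sum_comm]
        conv_rhs => rw [Finset.sum_comm]
        refine Finset.sum_congr rfl fun l _ => ?_
        rw [Finset.sum_comm]
      map_star' := by
        intro X
        simp only [star_sum, star_smul, star_mul, star_star, Matrix.star_apply]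
        rw [Finset.sum_comm] }
  refine ⟨γ, fun X => ?_⟩
  conv_rhs => rw [hsum X]
  have : γ X = ∑ i, ∑ j, X i j • (star (v i) * v j) := rfl
  rw [this]
  simp only [map_sum, map_smul, map_mul, map_star, hv]
  refine Finset.sum_congr rfl fun i _ => Finset.sum_congr rfl fun j _ => ?_
  rw [← map_star, ← map_mul, hEstar, hEmul, if_pos rfl]

theorem matrix_algebra_WstarCstar_projective_nonunital
    {H : Type*} [NormedAddCommGroup H] [InnerProductSpace ℂ H] [CompleteSpace H]
    (B : VonNeumannAlgebra H)
    {M : Type*} [NormedRing M] [StarRing M] [CStarRing M] [CompleteSpace M]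
    [NormedAlgebra ℂ M] [StarModule ℂ M]
    (π : B.toStarSubalgebra →⋆ₐ[ℂ] M) (hπ : Function.Surjective π)
    (n : ℕ) (ρ : Matrix (Fin n) (Fin n) ℂ →⋆ₙₐ[ℂ] M) :
    ∃ γ : Matrix (Fin n) (Fin n) ℂ →⋆ₙₐ[ℂ] B.toStarSubalgebra,
      ∀ x, π (γ x) = ρ x := by
  letI : CStarAlgebra M := { }
  haveI : IsClosed (B.toStarSubalgebra : Set (H →L[ℂ] H)) := by
    rw [VonNeumannAlgebra.coe_toStarSubalgebra, ← B.centralizer_centralizer]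
    exact Set.isClosed_centralizer _
  exact lift_abstract π hπ (vn_range_proj B) n ρ
end

section
/- Let π : B → M be a surjective unital *-homomorphism from a von Neumann algebra B onto a unital C*-algebra M, and let v ∈ M be a partial isometry (v v* v = v). Then there exists a partial isometry V ∈ B with π(V) = v. -/
lemma aux_lift {A M : Type*} [CStarAlgebra A] [CStarAlgebra M] (π : A →⋆ₐ[ℂ] M)
    (hπ : Function.Surjective π)
    (hA : ∀ g : A, ∃ p : A, IsStarProjection p ∧ p * g = g ∧ ∀ x : A, x * g = 0 → x * p = 0)
    (v : M) (hv : v * star v * v = v) :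
    ∃ V : A, V * star V * V = V ∧ π V = v := by
  obtain ⟨b, rfl⟩ := hπ v
  have hcont : Continuous π :=
    AddMonoidHomClass.continuous_of_bound π 1 fun x => by
      simpa using NonUnitalStarAlgHom.norm_apply_le (π : A →⋆ₙₐ[ℂ] M) x
  set a : A := star b * b with ha
  have hsa : IsSelfAdjoint a := IsSelfAdjoint.star_mul_self b
  set q : M := π a with hq
  have hqsa : IsSelfAdjoint q := hsa.map π
  have hqe : q = star (π b) * π b := by rw [hq, ha, map_mul, map_star]
  have hvq : π b * q = π b := by rw [hqe, ← mul_assoc, hv]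
  have hqq : IsIdempotentElem q := by
    show q * q = q
    nth_rewrite 1 [hqe]
    rw [mul_assoc, hvq, hqe]
  let h : ℝ → ℝ := fun t => (√(max t (1/2)))⁻¹
  let g : ℝ → ℝ := fun t => max (t - 1/2) 0
  have hpos : ∀ t : ℝ, 0 < √(max t (1/2)) := fun t =>
    Real.sqrt_pos.2 (lt_of_lt_of_le (by norm_num) (le_max_right _ _))
  have hc : Continuous h := by
    refine Continuous.inv₀ (by fun_prop) fun t => (hpos t).ne'
  have gc : Continuous g := by fun_prop
  have hfg : ∀ t, (h t * t * h t - 1) * g t = 0 := by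
    intro t
    rcases le_total t (1/2) with ht | ht
    · have : g t = 0 := max_eq_right (by linarith)
      simp [this]
    · have h1 : h t * t * h t = 1 := by
        have h0 := hpos t
        have h2 : h t = (√t)⁻¹ := by simp only [h, max_eq_left ht]
        rw [max_eq_left ht] at h0
        rw [h2]
        field_simp
        exact (Real.sq_sqrt (by linarith)).symm
      simp [h1]
  have hspec : ∀ t ∈ spectrum ℝ q, t = 0 ∨ t = 1 := by
    intro t ht
    simpa using hqq.spectrum_subset ℝ ht
  have hh1 : h 1 = 1 := by
    have : max (1:ℝ) (1/2) = 1 := max_eq_left (by norm_num)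
    simp only [h, this, Real.sqrt_one, inv_one]
  have hmap : ∀ f : ℝ → ℝ, Continuous f → π (cfc f a) = cfc f q := fun f hf =>
    StarAlgHomClass.map_cfc (S := ℂ) π f a hf.continuousOn hcont hsa hqsa
  have e1 : cfc h a * a * cfc h a - 1 = cfc (fun t => h t * t * h t - 1) a := by
    rw [cfc_sub (fun t => h t * t * h t) (fun _ => 1) a (by fun_prop) (by fun_prop), cfc_const_one ℝ a,
      cfc_mul (fun t => h t * t) h a (by fun_prop) (by fun_prop),
      cfc_mul h (fun t => t) a (by fun_prop) (by fun_prop), cfc_id' ℝ a]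
  have e2 : (cfc h a * a * cfc h a - 1) * cfc g a = 0 := by
    rw [e1, ← cfc_mul _ _ a (by fun_prop) (by fun_prop)]
    simp only [hfg]
    exact cfc_const_zero ℝ a
  obtain ⟨p, hp, hpg, hpx⟩ := hA (cfc g a)
  have e3 : cfc h a * a * cfc h a * p = p := by
    have := hpx _ e2
    rw [sub_mul, one_mul, sub_eq_zero] at this
    exact this
  have m1 : cfc h q * q = q := by
    have e4 : cfc (fun t => h t * t) q = cfc h q * q := by
      rw [cfc_mul h (fun t => t) q (by fun_prop) (by fun_prop), cfc_id' ℝ q]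
    rw [← e4]
    refine Eq.trans ?_ (cfc_id' ℝ q)
    apply cfc_congr
    intro t ht
    rcases hspec t ht with rfl | rfl <;> simp [hh1]
  have m1' : q * cfc h q = q := by
    have := congrArg star m1
    rwa [star_mul, hqsa.star_eq, (cfc_predicate h q : IsSelfAdjoint _).star_eq] at this
  have m2 : (2:ℝ) • cfc g q = q := by
    rw [← cfc_smul _ _ q (by fun_prop)]
    nth_rewrite 2 [← cfc_id' ℝ q]
    apply cfc_congr
    intro t ht
    rcases hspec t ht with rfl | rfl <;> norm_num [g]
  have m3 : π p * q = q := by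
    rw [← m2, mul_smul_comm, ← hmap g gc, ← map_mul, hpg]
  have m4 : q * π p = π p := by
    have := congrArg π e3
    simp only [map_mul, hmap h hc] at this
    rwa [← hq, m1, m1'] at this
  have m5 : π p = q := by
    have h1 := congrArg star m4
    have h2 : star (π p) = π p := by rw [← map_star, hp.isSelfAdjoint.star_eq]
    rw [star_mul, hqsa.star_eq, h2] at h1
    rw [← h1, m3]
  have hhs : star (cfc h a) = cfc h a := (cfc_predicate h a : IsSelfAdjoint _).star_eq
  refine ⟨b * cfc h a * p, ?_, ?_⟩
  · have : star (b * cfc h a * p) * (b * cfc h a * p) = p := by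
      calc _ = p * (cfc h a * a * cfc h a * p) := by
            rw [star_mul, star_mul, hhs, hp.isSelfAdjoint.star_eq]
            simp only [ha, mul_assoc]
        _ = p := by rw [e3, hp.isIdempotentElem.eq]
    rw [mul_assoc, this, mul_assoc, hp.isIdempotentElem.eq]
  · rw [map_mul, map_mul, hmap h hc, m5, mul_assoc, m1, hvq]

lemma aux_proj {H : Type*} [NormedAddCommGroup H] [InnerProductSpace ℂ H] [CompleteSpace H]
    (B : VonNeumannAlgebra H) (g : B.toStarSubalgebra) :
    ∃ p : B.toStarSubalgebra, IsStarProjection p ∧ p * g = g ∧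
      ∀ x : B.toStarSubalgebra, x * g = 0 → x * p = 0 := by
  obtain ⟨g, hg⟩ := g
  let K : Submodule ℂ H := (LinearMap.range (g : H →ₗ[ℂ] H)).topologicalClosure
  haveI : CompleteSpace K :=
    (Submodule.isClosed_topologicalClosure _).completeSpace_coe
  have hP : IsStarProjection K.starProjection := isStarProjection_starProjection
  have hmem : K.starProjection ∈ B := by
    rw [VonNeumannAlgebra.IsStarProjection.mem_iff hP]
    intro y hy
    rw [VonNeumannAlgebra.mem_commutant_iff] at hy
    have hy := hy g hg
    rw [Submodule.range_starProjection]
    show K ≤ K.comap (y : H →ₗ[ℂ] H)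
    apply Submodule.topologicalClosure_minimal
    · rintro _ ⟨z, rfl⟩
      apply Submodule.le_topologicalClosure
      exact ⟨y z, congr($hy z)⟩
    · exact (Submodule.isClosed_topologicalClosure _).preimage y.continuous
  refine ⟨⟨K.starProjection, hmem⟩, ⟨Subtype.ext hP.isIdempotentElem, Subtype.ext hP.isSelfAdjoint⟩, ?_, ?_⟩
  · apply Subtype.ext
    ext z
    exact Submodule.starProjection_eq_self_iff.2 (Submodule.le_topologicalClosure _ ⟨z, rfl⟩)
  · rintro ⟨x, hx⟩ hxg
    have hxg : x * g = 0 := congrArg Subtype.val hxg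
    apply Subtype.ext
    ext z
    have : K ≤ LinearMap.ker (x : H →ₗ[ℂ] H) := by
      apply Submodule.topologicalClosure_minimal
      · rintro _ ⟨z, rfl⟩
        exact congr($hxg z)
      · exact x.isClosed_ker
    exact this (Submodule.starProjection_apply_mem K z)

/-- Partial isometries lift through a surjective unital *-homomorphism from a von Neumann
algebra onto a unital C*-algebra. -/
theorem partial_isometry_lifts_from_vonNeumann
    {H : Type*} [NormedAddCommGroup H] [InnerProductSpace ℂ H] [CompleteSpace H]
    (B : VonNeumannAlgebra H)
    {M : Type*} [NormedRing M] [StarRing M] [CStarRing M] [CompleteSpace M]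
    [NormedAlgebra ℂ M] [StarModule ℂ M]
    (π : B.toStarSubalgebra →⋆ₐ[ℂ] M) (hπ : Function.Surjective π)
    (v : M) (hv : v * star v * v = v) :
    ∃ V : B.toStarSubalgebra, V * star V * V = V ∧ π V = v := by
  letI : CStarAlgebra M := {}
  haveI hcl : IsClosed (B.toStarSubalgebra : Set (H →L[ℂ] H)) := by
    rw [VonNeumannAlgebra.coe_toStarSubalgebra, ← B.centralizer_centralizer]
    exact Set.isClosed_centralizer _
  haveI : CompleteSpace B.toStarSubalgebra := hcl.completeSpace_coe
  letI : CStarAlgebra B.toStarSubalgebra := {}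
  exact aux_lift π hπ (aux_proj B) v hv
end

section
/- Let A be a unital C*-algebra that is W*-C*-projective (respectively W*-W*-projective) in the non-unital category. Then for each n ∈ ℕ, the matrix algebra Mₙ(A) = Mₙ ⊗ A is W*-C*-projective (respectively W*-W*-projective) in the non-unital category. -/
/-- A star algebra `A` (e.g. a C*-algebra) is W*-C*-projective in the non-unital category if
every *-homomorphism from `A` into a C*-algebra `M` lifts through every surjective
*-homomorphism from a von Neumann algebra onto `M`. -/
def WstarCstarProjectiveNU (A : Type) [NonUnitalRing A] [StarRing A] [Module ℂ A] : Prop :=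
  ∀ (H : Type) [NormedAddCommGroup H] [InnerProductSpace ℂ H] [CompleteSpace H]
    (B : VonNeumannAlgebra H)
    (M : Type) [NonUnitalNormedRing M] [StarRing M] [CStarRing M] [CompleteSpace M]
    [NormedSpace ℂ M] [IsScalarTower ℂ M M] [SMulCommClass ℂ M M] [StarModule ℂ M]
    (π : B.toStarSubalgebra →⋆ₙₐ[ℂ] M), Function.Surjective π →
    ∀ φ : A →⋆ₙₐ[ℂ] M, ∃ ψ : A →⋆ₙₐ[ℂ] B.toStarSubalgebra, ∀ x, π (ψ x) = φ x

/-- A star algebra `A` is W*-W*-projective in the non-unital category if every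
*-homomorphism from `A` into a von Neumann algebra `M` lifts through every surjective
*-homomorphism from a von Neumann algebra onto `M`. -/
def WstarWstarProjectiveNU (A : Type) [NonUnitalRing A] [StarRing A] [Module ℂ A] : Prop :=
  ∀ (H₁ H₂ : Type)
    [NormedAddCommGroup H₁] [InnerProductSpace ℂ H₁] [CompleteSpace H₁]
    [NormedAddCommGroup H₂] [InnerProductSpace ℂ H₂] [CompleteSpace H₂]
    (B : VonNeumannAlgebra H₁) (W : VonNeumannAlgebra H₂)
    (π : B.toStarSubalgebra →⋆ₙₐ[ℂ] W.toStarSubalgebra), Function.Surjective π →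
    ∀ φ : A →⋆ₙₐ[ℂ] W.toStarSubalgebra,
      ∃ ψ : A →⋆ₙₐ[ℂ] B.toStarSubalgebra, ∀ x, π (ψ x) = φ x


lemma rickart_commute {B : Type*} [Ring B] [StarRing B] {a q x : B} (ha : star a = a) (hq : star q = q)
    (hqa : q * a = a) (hk : ∀ x, a * x = 0 → q * x = 0) (hx : star x = x) (hxa : a * x = x * a) :
    q * x = x * q := by
  have haq : a * q = a := by
    have := congrArg star hqa
    rwa [star_mul, ha, hq] at this
  have h1 : q * (x * (1 - q)) = 0 := by
    apply hk
    rw [← mul_assoc, hxa, mul_assoc, mul_sub, mul_one, haq, sub_self, mul_zero]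
  have h2 : q * x = q * x * q := by
    have : q * x - q * x * q = 0 := by rw [← h1]; noncomm_ring
    exact sub_eq_zero.mp this
  have h3 := congrArg star h2
  simp only [star_mul, hq, hx] at h3
  rw [h2, h3, mul_assoc]

lemma cfcn_proj {M : Type*} [NonUnitalCStarAlgebra M] (p : M) (hs : IsSelfAdjoint p) (hp : p * p = p)
    (g : ℝ → ℝ) (h0 : g 0 = 0) (h1 : g 1 = 1) : cfcₙ g p = p := by
  have key : Set.EqOn g id (quasispectrum ℝ p) := by
    intro t ht
    rcases IsIdempotentElem.quasispectrum_subset ℝ (show IsIdempotentElem p from hp) ht with h | h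
    · simp [h, h0]
    · have : t = 1 := h
      simp [this, h1]
  rw [cfcₙ_congr key]
  exact cfcₙ_id ℝ p

lemma exists_funs : ∃ h k : ℝ → ℝ, Continuous h ∧ Continuous k ∧ h 0 = 0 ∧ h 1 = 1 ∧ k 0 = 0 ∧
    k 1 = 1 ∧ ∀ t, h t * (k t * t * t * (k t * t)) = h t := by
  let m : ℝ → ℝ := fun t => max t (1/2)
  have hm0 : ∀ t, 0 < m t := fun t => lt_of_lt_of_le (by norm_num) (le_max_right _ _)
  have hm : Continuous m := by fun_prop
  let h : ℝ → ℝ := fun t => 2 * (m t - 1/2)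
  have hh : Continuous h := by fun_prop
  have hh0 : h 0 = 0 := by simp [h, m]
  have hh1 : h 1 = 1 := by simp [h, m]; norm_num
  let k : ℝ → ℝ := fun t => t / ((m t)^2 * Real.sqrt (m t))
  have hk : Continuous k := by
    refine continuous_id.div (by fun_prop) (fun t => ?_)
    have := hm0 t
    positivity
  have hk0 : k 0 = 0 := by simp [k]
  let g : ℝ → ℝ := fun t => k t * t
  have hg : Continuous g := by fun_prop
  have hg0 : g 0 = 0 := by simp [g]
  have hg1 : g 1 = 1 := by simp [g, k, m]; norm_num
  have hgh : ∀ t, h t * (g t * t * g t) = h t := by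
    intro t
    rcases le_total t (1/2) with ht | ht
    · simp only [h, m, max_eq_right ht]; ring
    · have ht0 : 0 < t := by linarith
      have hs : Real.sqrt t ^ 2 = t := Real.sq_sqrt ht0.le
      have hs0 : 0 < Real.sqrt t := Real.sqrt_pos.mpr ht0
      have : g t * t * g t = 1 := by
        simp only [g, k, m, max_eq_left ht]
        field_simp
        rw [hs]
      rw [this, mul_one]
  refine ⟨h, k, hh, hk, hh0, hh1, hk0, ?_, hgh⟩
  simp [k, m]; norm_num

lemma lift_polar {B M : Type*} [CStarAlgebra B] [NonUnitalCStarAlgebra M]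
    (hB : ∀ a : B, star a = a → ∃ q : B, star q = q ∧ q * q = q ∧ q * a = a ∧
      ∀ x, a * x = 0 → q * x = 0)
    (π : B →⋆ₙₐ[ℂ] M) (z : B) (hz : IsSelfAdjoint z) (p : M) (hp : p * p = p) (hπ : π z = p) :
    ∃ w q u : B, star w = w ∧ star q = q ∧ q * q = q ∧ w * q = w ∧ w * z * w = q ∧ w = u * z ∧
      π w = p ∧ π q = p := by
  have hps : IsSelfAdjoint p := by rw [← hπ]; exact hz.map π
  obtain ⟨h, k, hh, hk, hh0, hh1, hk0, hk1, hgh'⟩ := exists_funs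
  obtain ⟨g, hgdef⟩ : ∃ g : ℝ → ℝ, g = fun t => k t * t := ⟨_, rfl⟩
  have hg : Continuous g := by rw [hgdef]; exact hk.mul continuous_id
  have hg0 : g 0 = 0 := by simp [hgdef]
  have hg1 : g 1 = 1 := by simp [hgdef, hk1]
  have hgh : (fun t => h t * (g t * t * g t)) = h := by
    funext t; simp only [hgdef]; exact hgh' t
  have map (f : ℝ → ℝ) (hf : Continuous f) (h0 : f 0 = 0) (h1 : f 1 = 1) : π (cfcₙ f z) = p := by
    rw [NonUnitalStarAlgHomClass.map_cfcₙ π f z hf.continuousOn h0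
      (NonUnitalStarAlgHom.instContinuousLinearMapClassComplex.map_continuous π) hz
      (hz.map π), hπ]
    exact cfcn_proj p hps hp f h0 h1
  set a := cfcₙ h z with ha
  set G := cfcₙ g z with hG
  set K := cfcₙ k z with hK
  have hGK : G = K * z := by
    rw [hG, hgdef, cfcₙ_mul k (fun t => t) z hk.continuousOn hk0 continuousOn_id rfl,
      cfcₙ_id' ℝ z]
  have has : star a = a := (cfcₙ_predicate h z : IsSelfAdjoint _)
  have hGs : star G = G := (cfcₙ_predicate g z : IsSelfAdjoint _)
  have haG : a * (G * z * G) = a := by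
    have : cfcₙ (fun t => h t * (g t * t * g t)) z = a * (G * z * G) := by
      have c1 : Continuous (fun t => g t * t) := hg.mul continuous_id
      rw [cfcₙ_mul h (fun t => g t * t * g t) z hh.continuousOn hh0 (c1.mul hg).continuousOn
          (by simp), cfcₙ_mul (fun t => g t * t) g z c1.continuousOn (by simp) hg.continuousOn hg0,
        cfcₙ_mul g (fun t => t) z hg.continuousOn hg0 continuousOn_id rfl, cfcₙ_id' ℝ z]
    rw [← this, hgh]
  obtain ⟨q, hqs, hqq, hqa, hqk⟩ := hB a has
  have hqG : q * G = G * q := rickart_commute has hqs hqa hqk hGs (cfcₙ_commute_cfcₙ h g z)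
  have hqz : q * z = z * q := rickart_commute has hqs hqa hqk hz
    (by have := cfcₙ_commute_cfcₙ h (fun t => t) z
        rwa [cfcₙ_id' ℝ z] at this)
  have hqGG : q * (G * z * G) = q := by
    have : q * (G * z * G - 1) = 0 := hqk _ (by rw [mul_sub, haG, mul_one, sub_self])
    rw [mul_sub, mul_one] at this
    exact sub_eq_zero.mp this
  have πG : π G = p := map g hg hg0 hg1
  have πa : π a = p := map h hh hh0 hh1
  have πq : π q = p := by
    have e1 := congrArg π hqa
    have e2 := congrArg π hqGG
    simp only [map_mul, πG, πa, hπ, hp] at e1 e2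
    rw [← e2, e1]
  refine ⟨q * G, q, q * K, ?_, hqs, hqq, ?_, ?_, ?_, ?_, πq⟩
  · rw [star_mul, hqs, hGs, hqG]
  · rw [mul_assoc, ← hqG, ← mul_assoc, hqq]
  · calc q * G * z * (q * G) = q * G * (z * q) * G := by noncomm_ring
      _ = q * (G * q) * z * G := by rw [← hqz]; noncomm_ring
      _ = q * q * (G * z * G) := by rw [← hqG]; noncomm_ring
      _ = q := by rw [hqq, hqGG]
  · rw [hGK, mul_assoc]
  · rw [map_mul, πq, πG, hp]

lemma lift_columns {B M : Type*} [CStarAlgebra B] [NonUnitalCStarAlgebra M]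
    (hB : ∀ a : B, star a = a → ∃ q : B, star q = q ∧ q * q = q ∧ q * a = a ∧
      ∀ x, a * x = 0 → q * x = 0)
    (π : B →⋆ₙₐ[ℂ] M) (hπ : Function.Surjective π) {ι : Type*} [DecidableEq ι] (o : ι)
    (e : ι → ι → M) (he : ∀ i j k l, e i j * e k l = if j = k then e i l else 0)
    (hes : ∀ i j, star (e i j) = e j i) (s : Finset ι) :
    ∃ (q : B) (v : ι → B), star q = q ∧ q * q = q ∧ (∀ i, e i o * π q = e i o) ∧
      (∀ i ∈ s, π (v i) = e i o) ∧ (∀ i ∈ s, v i * q = v i) ∧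
      (∀ i ∈ s, ∀ j ∈ s, star (v i) * v j = if i = j then q else 0) := by
  induction s using Finset.induction_on with
  | empty =>
    refine ⟨1, 0, by simp, by simp, ?_, by simp, by simp, by simp⟩
    intro i
    obtain ⟨b, hb⟩ := hπ (e i o)
    rw [← hb, ← map_mul, mul_one]
  | insert k s hk ih =>
    obtain ⟨q, v, hqs, hqq, hqe, hvπ, hvq, hvv⟩ := ih
    obtain ⟨x, hx⟩ := hπ (e k o)
    set F := ∑ i ∈ s, v i * star (v i) with hF
    set y := x * q - F * (x * q) with hy
    have hFv : ∀ i ∈ s, F * v i = v i := by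
      intro i hi
      rw [hF, Finset.sum_mul, Finset.sum_eq_single i]
      · rw [mul_assoc, hvv i hi i hi, if_pos rfl, hvq i hi]
      · intro j hj hji
        rw [mul_assoc, hvv j hj i hi, if_neg hji, mul_zero]
      · exact fun h => absurd hi h
    have hFs : star F = F := by simp [hF, star_sum]
    have hyv : ∀ i ∈ s, star y * v i = 0 := by
      intro i hi
      have : star y * v i = star (x * q) * (v i - F * v i) := by
        rw [hy, star_sub, star_mul F, hFs]; noncomm_ring
      rw [this, hFv i hi, sub_self, mul_zero]
    have hyq : y * q = y := by
      rw [hy, sub_mul, mul_assoc F, mul_assoc x, hqq]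
    have πF : π F * e k o = 0 := by
      rw [hF, map_sum, Finset.sum_mul]
      refine Finset.sum_eq_zero fun i hi => ?_
      have : i ≠ k := fun h => hk (h ▸ hi)
      rw [map_mul, map_star, hvπ i hi, hes, mul_assoc, he, if_neg this, mul_zero]
    have πy : π y = e k o := by
      rw [hy, map_sub, map_mul π F, map_mul, hx, hqe, πF, sub_zero]
    obtain ⟨w, r, u, hws, hrs, hrr, hwr, hwzw, hwu, πw, πr⟩ :=
      lift_polar hB π (star y * y) (IsSelfAdjoint.star_mul_self y) (e o o)
        (by rw [he, if_pos rfl]) (by rw [map_mul, map_star, πy, hes, he, if_pos rfl])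
    have hwq : w * q = w := by rw [hwu, mul_assoc, mul_assoc, hyq]
    have hrq : r * q = r := by rw [← hwzw, mul_assoc, hwq]
    have hqr : q * r = r := by
      have := congrArg star hrq
      rwa [star_mul, hrs, hqs] at this
    refine ⟨r, fun i => if i = k then y * w else v i * r, hrs, hrr, ?_, ?_, ?_, ?_⟩
    · intro i; rw [πr, he, if_pos rfl]
    · intro i hi
      dsimp only
      by_cases hik : i = k
      · subst hik
        rw [if_pos rfl, map_mul, πy, πw, he, if_pos rfl]
      · rw [if_neg hik, map_mul, πr, hvπ i ((Finset.mem_insert.mp hi).resolve_left hik), he,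
          if_pos rfl]
    · intro i hi
      dsimp only
      split_ifs
      · rw [mul_assoc, hwr]
      · rw [mul_assoc, hrr]
    · intro i hi j hj
      dsimp only
      by_cases hik : i = k <;> by_cases hjk : j = k
      · rw [if_pos hik, if_pos hjk, if_pos (hik.trans hjk.symm), star_mul, hws, ← hwzw]
        noncomm_ring
      · have hj' := (Finset.mem_insert.mp hj).resolve_left hjk
        rw [if_pos hik, if_neg hjk, if_neg (fun h : i = j => hjk (h ▸ hik)), star_mul, ← mul_assoc,
          mul_assoc (star w), hyv j hj', mul_zero, zero_mul]
      · have hi' := (Finset.mem_insert.mp hi).resolve_left hik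
        have := congrArg star (hyv i hi')
        rw [star_mul, star_star, star_zero] at this
        rw [if_neg hik, if_pos hjk, if_neg (fun h : i = j => hik (h ▸ hjk)), star_mul, ← mul_assoc,
          mul_assoc (star r), this, mul_zero, zero_mul]
      · have hi' := (Finset.mem_insert.mp hi).resolve_left hik
        have hj' := (Finset.mem_insert.mp hj).resolve_left hjk
        rw [if_neg hik, if_neg hjk, star_mul, ← mul_assoc, mul_assoc (star r), hvv i hi' j hj',
          hrs]
        split_ifs
        · rw [hrq, hrr]
        · rw [mul_zero, zero_mul]

lemma lift_units {B M : Type*} [CStarAlgebra B] [NonUnitalCStarAlgebra M]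
    (hB : ∀ a : B, star a = a → ∃ q : B, star q = q ∧ q * q = q ∧ q * a = a ∧
      ∀ x, a * x = 0 → q * x = 0)
    (π : B →⋆ₙₐ[ℂ] M) (hπ : Function.Surjective π) {ι : Type*} [DecidableEq ι] [Fintype ι] (o : ι)
    (e : ι → ι → M) (he : ∀ i j k l, e i j * e k l = if j = k then e i l else 0)
    (hes : ∀ i j, star (e i j) = e j i) :
    ∃ f : ι → ι → B, (∀ i j k l, f i j * f k l = if j = k then f i l else 0) ∧
      (∀ i j, star (f i j) = f j i) ∧ ∀ i j, π (f i j) = e i j := by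
  obtain ⟨q, v, hqs, hqq, hqe, hvπ, hvq, hvv⟩ := lift_columns hB π hπ o e he hes Finset.univ
  simp only [Finset.mem_univ, true_imp_iff] at hvπ hvq hvv
  refine ⟨fun i j => v i * star (v j), ?_, ?_, ?_⟩
  · intro i j k l
    dsimp only
    rw [mul_assoc, ← mul_assoc (star (v j)), hvv]
    split_ifs
    · rw [← mul_assoc, hvq]
    · simp
  · intro i j; simp
  · intro i j
    rw [map_mul, map_star, hvπ, hvπ, hes, he, if_pos rfl]

/-- elements commuting with the matrix units lift to elements commuting with the matrix units -/
lemma lift_commuting {B M : Type*} [NonUnitalRing B] [NonUnitalRing M] {F : Type*} [FunLike F B M]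
    [NonUnitalRingHomClass F B M] (π : F) (hπ : Function.Surjective π)
    {ι : Type*} [DecidableEq ι] [Fintype ι] (o : ι)
    (e : ι → ι → M) (he : ∀ i j k l, e i j * e k l = if j = k then e i l else 0)
    (f : ι → ι → B) (hf : ∀ i j k l, f i j * f k l = if j = k then f i l else 0)
    (hfe : ∀ i j, π (f i j) = e i j) (m : M) (hm : ∀ i j, e i j * m = m * e i j) :
    ∃ b, π b = m ∧ ∀ i j, f i j * b = b * f i j := by
  obtain ⟨b, rfl⟩ := hπ m
  set P := ∑ i, f i i with hP
  have h1 : ∀ i j, P * f i j = f i j := by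
    intro i j
    simp [hP, Finset.sum_mul, hf]
  have h2 : ∀ i j, f i j * P = f i j := by
    intro i j
    simp [hP, Finset.mul_sum, hf]
  have hPm : π P * π b = π b * π P := by
    simp only [hP, map_sum, Finset.sum_mul, Finset.mul_sum, hfe, hm]
  have hPP : π P * π P = π P := by
    rw [← map_mul]; congr 1
    conv_lhs => rw [hP, Finset.mul_sum]
    simp [h1, ← hP]
  refine ⟨∑ i, f i o * b * f o i + (b - P * b - (b - P * b) * P), ?_, ?_⟩
  · have : π (∑ i, f i o * b * f o i) = π b * π P := by
      simp only [hP, map_sum, map_mul, hfe, hm, Finset.mul_sum]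
      simp only [mul_assoc, he, if_true]
    rw [map_add, this]
    have h3 : π P * π b * π P = π b * π P := by rw [hPm, mul_assoc, hPP]
    simp only [map_sub, map_mul, sub_mul, h3]
    rw [hPm]
    abel
  · intro i j
    have a1 : f i j * ∑ i, f i o * b * f o i = f i o * b * f o j := by
      simp only [Finset.mul_sum, ← mul_assoc, hf, ite_mul, zero_mul]
      simp
    have a2 : (∑ i, f i o * b * f o i) * f i j = f i o * b * f o j := by
      simp only [Finset.sum_mul, mul_assoc, hf, mul_ite, mul_zero]
      simp
    rw [mul_add, add_mul, a1, a2]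
    congr 1
    simp only [mul_sub, sub_mul, ← mul_assoc, h2]
    simp only [mul_assoc, h1]
    simp

/-- assembling the lift -/
lemma assemble {A B M : Type*} [Ring A] [StarRing A] [Algebra ℂ A] 
    [NonUnitalRing B] [StarRing B] [Module ℂ B] [IsScalarTower ℂ B B] [SMulCommClass ℂ B B]
    [NonUnitalRing M] [StarRing M] [Module ℂ M]
    {ι : Type*} [DecidableEq ι] [Fintype ι]
    (π : B →⋆ₙₐ[ℂ] M) (φ : Matrix ι ι A →⋆ₙₐ[ℂ] M)
    (f : ι → ι → B) (hf : ∀ i j k l, f i j * f k l = if j = k then f i l else 0)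
    (hfs : ∀ i j, star (f i j) = f j i)
    (hfe : ∀ i j, π (f i j) = φ (Matrix.single i j 1))
    (ψ : A →⋆ₙₐ[ℂ] B) (hc : ∀ i j a, f i j * ψ a = ψ a * f i j)
    (hψ : ∀ a, π (ψ a) = φ (Matrix.diagonal fun _ => a)) :
    ∃ Ψ : Matrix ι ι A →⋆ₙₐ[ℂ] B, ∀ x, π (Ψ x) = φ x := by
  obtain ⟨T, hT⟩ : ∃ T : Matrix ι ι A → B, ∀ x, T x = ∑ i, ∑ j, f i j * ψ (x i j) :=
    ⟨_, fun _ => rfl⟩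
  have t1 : ∀ (c : ℂ) x, T (c • x) = c • T x := by
    intro c x
    simp [hT, Finset.smul_sum, mul_smul_comm]
  have t2 : T 0 = 0 := by simp [hT]
  have t3 : ∀ x y, T (x + y) = T x + T y := by
    intro x y
    simp [hT, mul_add, Finset.sum_add_distrib]
  have t4 : ∀ x y, T (x * y) = T x * T y := by
    intro x y
    have key : ∀ i j k l, f i j * ψ (x i j) * (f k l * ψ (y k l)) =
        if j = k then f i l * (ψ (x i j) * ψ (y k l)) else 0 := by
      intro i j k l
      rw [mul_assoc, ← mul_assoc (ψ _), ← hc, mul_assoc, ← mul_assoc, hf]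
      split_ifs <;> simp
    have lhs : T (x * y) = ∑ i, ∑ l, ∑ j, f i l * (ψ (x i j) * ψ (y j l)) := by
      simp only [hT, Matrix.mul_apply, map_sum, map_mul, Finset.mul_sum]
    have rhs : T x * T y = ∑ i, ∑ j, ∑ k, ∑ l, f i j * ψ (x i j) * (f k l * ψ (y k l)) := by
      simp only [hT, Finset.sum_mul]
      simp only [Finset.mul_sum]
    rw [lhs, rhs]
    simp only [key]
    refine Finset.sum_congr rfl fun i _ => ?_
    rw [Finset.sum_comm]
    refine Finset.sum_congr rfl fun j _ => ?_
    rw [Finset.sum_comm]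
    simp
  have t5 : ∀ x, T (star x) = star (T x) := by
    intro x
    simp only [hT, star_sum, star_mul, hfs, Matrix.star_apply, map_star]
    rw [Finset.sum_comm]
    refine Finset.sum_congr rfl fun i _ => Finset.sum_congr rfl fun j _ => ?_
    rw [← map_star, hc]
  refine ⟨{ toFun := T
            map_smul' := t1
            map_zero' := t2
            map_add' := t3
            map_mul' := t4
            map_star' := t5 }, ?_⟩
  intro x
  change π (T x) = φ x
  rw [hT]
  conv_rhs => rw [Matrix.matrix_eq_sum_single x]
  simp only [map_sum, map_mul, hfe, hψ]
  refine Finset.sum_congr rfl fun i _ => Finset.sum_congr rfl fun j _ => ?_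
  rw [← map_mul]
  congr 1
  ext a b
  simp [Matrix.single_apply]

lemma vn_closed {H : Type*} [NormedAddCommGroup H] [InnerProductSpace ℂ H] [CompleteSpace H]
    (B : VonNeumannAlgebra H) : IsClosed (B.toStarSubalgebra : Set (H →L[ℂ] H)) := by
  rw [VonNeumannAlgebra.coe_toStarSubalgebra, ← B.centralizer_centralizer]
  exact Set.isClosed_centralizer _

lemma exists_relcomm {H : Type*} [NormedAddCommGroup H] [InnerProductSpace ℂ H] [CompleteSpace H]
    (B : VonNeumannAlgebra H) (S : Set (H →L[ℂ] H)) (hS : ∀ s ∈ S, star s ∈ S) :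
    ∃ D : VonNeumannAlgebra H, ∀ x, x ∈ D.toStarSubalgebra ↔
      x ∈ B.toStarSubalgebra ∧ ∀ s ∈ S, s * x = x * s := by
  let T : Set (H →L[ℂ] H) := (B.commutant : Set (H →L[ℂ] H)) ∪ S
  refine ⟨⟨StarSubalgebra.centralizer ℂ T, by simp⟩, fun x => ?_⟩
  change x ∈ StarSubalgebra.centralizer ℂ T ↔ _
  rw [StarSubalgebra.mem_centralizer_iff]
  have hB : x ∈ B.toStarSubalgebra ↔ ∀ g ∈ B.commutant, g * x = x * g := by
    rw [← VonNeumannAlgebra.mem_commutant_iff, VonNeumannAlgebra.commutant_commutant]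
    rfl
  rw [hB]
  constructor
  · intro h
    exact ⟨fun g hg => (h g (Or.inl hg)).1, fun g hg => (h g (Or.inr hg)).1⟩
  · rintro ⟨h1, h2⟩ g (hg | hg)
    · exact ⟨h1 g hg, h1 _ (star_mem hg)⟩
    · exact ⟨h2 g hg, h2 _ (hS g hg)⟩

lemma vn_rickart {H : Type*} [NormedAddCommGroup H] [InnerProductSpace ℂ H] [CompleteSpace H]
    (B : VonNeumannAlgebra H) (a : B.toStarSubalgebra) (ha : star a = a) :
    ∃ q : B.toStarSubalgebra, star q = q ∧ q * q = q ∧ q * a = a ∧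
      ∀ x, a * x = 0 → q * x = 0 := by
  obtain ⟨a, haB⟩ := a
  have ha' : star a = a := congrArg Subtype.val ha
  have : CompleteSpace a.ker := a.isClosed_ker.completeSpace_coe
  set r := a.ker.starProjection with hr
  have hrp : IsStarProjection r := isStarProjection_starProjection
  have har : a * r = 0 := by
    ext v
    exact a.ker.starProjection_apply_mem v
  have hra : r * a = 0 := by
    have := congrArg star har
    rwa [star_mul, ha', hrp.isSelfAdjoint.star_eq, star_zero] at this
  have hrk : ∀ x, a * x = 0 → r * x = x := by
    intro x hx
    ext v
    exact Submodule.starProjection_eq_self_iff.mpr (congrArg (fun y : H →L[ℂ] H => y v) hx)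
  have hrB : r ∈ B := by
    rw [VonNeumannAlgebra.IsStarProjection.mem_iff hrp]
    intro y hy
    rw [VonNeumannAlgebra.mem_commutant_iff] at hy
    have hay : a * y = y * a := hy a haB
    rw [hr, Submodule.range_starProjection]
    intro v hv
    have hv' : a v = 0 := hv
    change a (y v) = 0
    have : a (y v) = y (a v) := congrArg (fun z : H →L[ℂ] H => z v) hay
    rw [this, hv', map_zero]
  have hqB : 1 - r ∈ B.toStarSubalgebra := sub_mem (one_mem _) hrB
  refine ⟨⟨1 - r, hqB⟩, ?_, ?_, ?_, ?_⟩
  · apply Subtype.ext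
    exact hrp.one_sub.isSelfAdjoint.star_eq
  · apply Subtype.ext
    exact hrp.one_sub.isIdempotentElem
  · apply Subtype.ext
    change (1 - r) * a = a
    rw [sub_mul, hra, one_mul, sub_zero]
  · rintro ⟨x, hx⟩ h
    apply Subtype.ext
    change (1 - r) * x = 0
    rw [sub_mul, hrk x (congrArg Subtype.val h), one_mul, sub_self]

lemma vn_lift_units {H : Type*} [NormedAddCommGroup H] [InnerProductSpace ℂ H] [CompleteSpace H]
    (B : VonNeumannAlgebra H) {M : Type*} [NonUnitalCStarAlgebra M]
    (π : B.toStarSubalgebra →⋆ₙₐ[ℂ] M) (hπ : Function.Surjective π)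
    {ι : Type*} [DecidableEq ι] [Fintype ι] (o : ι)
    (e : ι → ι → M) (he : ∀ i j k l, e i j * e k l = if j = k then e i l else 0)
    (hes : ∀ i j, star (e i j) = e j i) :
    ∃ f : ι → ι → B.toStarSubalgebra, (∀ i j k l, f i j * f k l = if j = k then f i l else 0) ∧
      (∀ i j, star (f i j) = f j i) ∧ ∀ i j, π (f i j) = e i j := by
  have := vn_closed B
  exact lift_units (B := B.toStarSubalgebra) (vn_rickart B) π hπ o e he hes

/-- the diagonal embedding -/
def diagHom (A : Type*) [Ring A] [StarRing A] [Algebra ℂ A] (ι : Type*) [DecidableEq ι]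
    [Fintype ι] : A →⋆ₙₐ[ℂ] Matrix ι ι A where
  toFun a := Matrix.diagonal fun _ => a
  map_smul' c a := Matrix.diagonal_smul c (fun _ => a)
  map_zero' := Matrix.diagonal_zero
  map_add' a b := (Matrix.diagonal_add _ _).symm
  map_mul' a b := (Matrix.diagonal_mul_diagonal _ _).symm
  map_star' a := (Matrix.diagonal_conjTranspose _).symm

lemma diag_comm {A : Type*} [Ring A] {ι : Type*} [DecidableEq ι]
    [Fintype ι] (i j : ι) (a : A) :
    Matrix.single i j 1 * Matrix.diagonal (fun _ => a) =
      Matrix.diagonal (fun _ => a) * Matrix.single i j (1 : A) := by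
  ext k l
  simp [Matrix.single_apply]

/-- restricting the codomain -/
def coRestr {A R : Type*} [NonUnitalRing A] [StarRing A] [Module ℂ A]
    [Ring R] [StarRing R] [Algebra ℂ R] [StarModule ℂ R] (S : StarSubalgebra ℂ R)
    (f : A →⋆ₙₐ[ℂ] R) (h : ∀ x, f x ∈ S) : A →⋆ₙₐ[ℂ] S where
  toFun x := ⟨f x, h x⟩
  map_smul' c a := Subtype.ext (map_smul f c a)
  map_zero' := Subtype.ext (map_zero f)
  map_add' a b := Subtype.ext (map_add f a b)
  map_mul' a b := Subtype.ext (map_mul f a b)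
  map_star' a := Subtype.ext (map_star f a)

/-- inclusion -/
def inclHom {R : Type*} [Ring R] [StarRing R] [Algebra ℂ R] [StarModule ℂ R]
    (S : StarSubalgebra ℂ R) : S →⋆ₙₐ[ℂ] R where
  toFun x := x
  map_smul' _ _ := rfl
  map_zero' := rfl
  map_add' _ _ := rfl
  map_mul' _ _ := rfl
  map_star' _ := rfl

/-- The common part: data reducing the lifting problem to relative commutants. -/
lemma common {A : Type*} [Ring A] [StarRing A] [Algebra ℂ A]
    {H : Type*} [NormedAddCommGroup H] [InnerProductSpace ℂ H] [CompleteSpace H]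
    (B : VonNeumannAlgebra H) {M : Type*} [NonUnitalCStarAlgebra M]
    (π : B.toStarSubalgebra →⋆ₙₐ[ℂ] M) (hπ : Function.Surjective π)
    {ι : Type*} [DecidableEq ι] [Fintype ι] (o : ι) (φ : Matrix ι ι A →⋆ₙₐ[ℂ] M) :
    ∃ (D : VonNeumannAlgebra H) (j : D.toStarSubalgebra →⋆ₙₐ[ℂ] B.toStarSubalgebra),
      (∀ d i k, φ (Matrix.single i k 1) * π (j d) = π (j d) * φ (Matrix.single i k 1)) ∧
      (∀ m, (∀ i k, φ (Matrix.single i k 1) * m = m * φ (Matrix.single i k 1)) →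
        ∃ d, π (j d) = m) ∧
      ∀ ψ : A →⋆ₙₐ[ℂ] D.toStarSubalgebra,
        (∀ a, π (j (ψ a)) = φ (Matrix.diagonal fun _ => a)) →
        ∃ Ψ : Matrix ι ι A →⋆ₙₐ[ℂ] B.toStarSubalgebra, ∀ x, π (Ψ x) = φ x := by
  have he : ∀ i j k l, φ (Matrix.single i j 1) * φ (Matrix.single k l 1) =
      if j = k then φ (Matrix.single i l 1) else 0 := by
    intro i j k l
    rw [← map_mul]
    split_ifs with h
    · subst h; simp
    · rw [Matrix.single_mul_single_of_ne _ _ _ _ h, map_zero]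
  have hes : ∀ i j, star (φ (Matrix.single i j 1)) = φ (Matrix.single j i 1) := by
    intro i j
    rw [← map_star, Matrix.star_eq_conjTranspose, Matrix.conjTranspose_single, star_one]
  obtain ⟨f, hf, hfs, hfe⟩ := vn_lift_units B π hπ o _ he hes
  obtain ⟨D, hD⟩ := exists_relcomm B (Set.range fun p : ι × ι => (f p.1 p.2 : H →L[ℂ] H)) (by
    rintro _ ⟨⟨i, k⟩, rfl⟩
    exact ⟨(k, i), congrArg Subtype.val (hfs i k).symm⟩)
  let j : D.toStarSubalgebra →⋆ₙₐ[ℂ] B.toStarSubalgebra :=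
    coRestr B.toStarSubalgebra (inclHom D.toStarSubalgebra) (fun x => ((hD _).mp x.2).1)
  have hj : ∀ d i k, f i k * j d = j d * f i k := fun d i k =>
    Subtype.ext (((hD _).mp d.2).2 _ ⟨(i, k), rfl⟩)
  refine ⟨D, j, ?_, ?_, ?_⟩
  · intro d i k
    rw [← hfe, ← map_mul, hj, map_mul]
  · intro m hm
    obtain ⟨b, hb, hbc⟩ := lift_commuting π hπ o _ he f hf hfe m hm
    refine ⟨⟨b, (hD _).mpr ⟨b.2, ?_⟩⟩, hb⟩
    rintro _ ⟨⟨i, k⟩, rfl⟩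
    exact congrArg Subtype.val (hbc i k)
  · intro ψ hψ
    exact assemble π φ f hf hfs hfe (j.comp ψ) (fun i k a => hj (ψ a) i k) hψ

/-- Theorem 5.2: if a unital C*-algebra `A` is W*-C*-projective (respectively
W*-W*-projective) in the non-unital category, then so is `Mₙ(A) = Mₙ ⊗ A` for every `n`. -/
theorem matrices_preserve_Wstar_projectivity
    (A : Type) [NormedRing A] [StarRing A] [CStarRing A] [CompleteSpace A]
    [NormedAlgebra ℂ A] [StarModule ℂ A] (n : ℕ) :
    (WstarCstarProjectiveNU A → WstarCstarProjectiveNU (Matrix (Fin n) (Fin n) A)) ∧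
    (WstarWstarProjectiveNU A → WstarWstarProjectiveNU (Matrix (Fin n) (Fin n) A)) := by
  constructor
  · intro hA H _ _ _ B M _ _ _ _ _ _ _ _ π hπ φ
    rcases n with _ | n
    · refine ⟨0, fun x => ?_⟩
      rw [Subsingleton.elim x 0, map_zero, map_zero, map_zero]
    let _ : NonUnitalCStarAlgebra M := {}
    obtain ⟨D, j, h1, h2, h3⟩ := common B π hπ (0 : Fin (n + 1)) φ
    let C : NonUnitalStarSubalgebra ℂ M := NonUnitalStarSubalgebra.centralizer ℂ
      (Set.range fun p : Fin (n + 1) × Fin (n + 1) => φ (Matrix.single p.1 p.2 1))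
    have hC : ∀ m, m ∈ C ↔ ∀ i k, φ (Matrix.single i k 1) * m = m * φ (Matrix.single i k 1) := by
      intro m
      rw [NonUnitalStarSubalgebra.mem_centralizer_iff]
      constructor
      · intro h i k
        exact (h _ ⟨(i, k), rfl⟩).1
      · rintro h _ ⟨⟨i, k⟩, rfl⟩
        refine ⟨h i k, ?_⟩
        rw [← map_star, Matrix.star_eq_conjTranspose, Matrix.conjTranspose_single, star_one]
        exact h k i
    have hcl : IsClosed (C : Set M) := by
      rw [NonUnitalStarSubalgebra.coe_centralizer]
      exact Set.isClosed_centralizer _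
    have : CompleteSpace C := hcl.completeSpace_coe
    obtain ⟨ψ, hψ⟩ := hA H D C
      (NonUnitalStarAlgHom.codRestrict (π.comp j) C (fun d => (hC _).mpr (h1 d)))
      (by
        rintro ⟨m, hm⟩
        obtain ⟨d, hd⟩ := h2 m ((hC m).mp hm)
        exact ⟨d, Subtype.ext hd⟩)
      (NonUnitalStarAlgHom.codRestrict (φ.comp (diagHom A (Fin (n + 1)))) C
        (fun a => (hC _).mpr fun i k => by
          change φ _ * φ (Matrix.diagonal fun _ => a) = φ (Matrix.diagonal fun _ => a) * φ _
          rw [← map_mul, diag_comm, map_mul]))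
    exact h3 ψ fun a => congrArg Subtype.val (hψ a)
  · intro hA H₁ H₂ _ _ _ _ _ _ B W π hπ φ
    rcases n with _ | n
    · refine ⟨0, fun x => ?_⟩
      rw [Subsingleton.elim x 0, map_zero, map_zero, map_zero]
    have := vn_closed W
    obtain ⟨D, j, h1, h2, h3⟩ := common B (M := W.toStarSubalgebra) π hπ (0 : Fin (n + 1)) φ
    obtain ⟨C, hC⟩ := exists_relcomm W (Set.range fun p : Fin (n + 1) × Fin (n + 1) =>
        (φ (Matrix.single p.1 p.2 1) : H₂ →L[ℂ] H₂)) (by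
      rintro _ ⟨⟨i, k⟩, rfl⟩
      refine ⟨(k, i), congrArg Subtype.val
        (?_ : φ (Matrix.single k i 1) = star (φ (Matrix.single i k 1)))⟩
      rw [← map_star, Matrix.star_eq_conjTranspose, Matrix.conjTranspose_single, star_one])
    have hC' : ∀ m : W.toStarSubalgebra,
        (∀ i k, φ (Matrix.single i k 1) * m = m * φ (Matrix.single i k 1)) →
        (m : H₂ →L[ℂ] H₂) ∈ C.toStarSubalgebra := by
      intro m hm
      refine (hC _).mpr ⟨m.2, ?_⟩
      rintro _ ⟨⟨i, k⟩, rfl⟩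
      exact congrArg Subtype.val (hm i k)
    obtain ⟨ψ, hψ⟩ := hA H₁ H₂ D C
      (coRestr C.toStarSubalgebra ((inclHom W.toStarSubalgebra).comp (π.comp j))
        (fun d => hC' _ (h1 d)))
      (by
        rintro ⟨m, hm⟩
        obtain ⟨d, hd⟩ := h2 ⟨m, ((hC m).mp hm).1⟩
          (fun i k => Subtype.ext (((hC m).mp hm).2 _ ⟨(i, k), rfl⟩))
        have hd' : ((π (j d) : W.toStarSubalgebra) : H₂ →L[ℂ] H₂) = m := by rw [hd]
        exact ⟨d, Subtype.ext hd'⟩)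
      (coRestr C.toStarSubalgebra
        ((inclHom W.toStarSubalgebra).comp (φ.comp (diagHom A (Fin (n + 1)))))
        (fun a => hC' _ fun i k => by
          change φ _ * φ (Matrix.diagonal fun _ => a) = φ (Matrix.diagonal fun _ => a) * φ _
          rw [← map_mul, diag_comm, map_mul]))
    refine h3 ψ fun a => ?_
    have h4 := congrArg Subtype.val (hψ a)
    exact Subtype.ext h4
end
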